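/- arXiv:2508.03150 — 3 statements merged into one kernel-verified Lean document; each statement's English description precedes it below -/
import Mathlib

section
/- Plücker-type relation for truncated Schur multiple zeta values, dual version (Corollary 5.4(2)): Let M be a positive integer and a : ℤ → ℂ. Let λ be a partition whose conjugate is λ' = (m_1^{r_1} m_2^{r_2−r_1} ⋯ m_n^{r_n−r_{n−1}}) with m_1 > ⋯ > m_n > 0 and 0 < r_1 < ⋯ < r_n (so λ has n corners). Fix 1 ≤ d ≤ n and set ℓ := r_d (the d-th shortest row length of λ). Then ζ^M_{λ}(a) · ζ^M_{λ}(τ a) = ζ^M_{(λ'−(1^ℓ))'}(a) · ζ^M_{(λ'+(1^ℓ))'}(τ a) + Σ_{t=1}^{min(d, n−d+1)} (−1)^{t−1} Σ_{1 ≤ p_1 < ⋯ < p_t ≤ d, d ≤ q_t < ⋯ < q_1 ≤ n} ζ^M_{(add^{p_1,…,p_t}_{q_1,…,q_t}(λ'))'}(a) · ζ^M_{(rem^{p_1,…,p_t}_{q_1,…,q_t}(λ'))'}(τ a), where the operators act on λ' via its corner data, ν' denotes the conjugate partition, and τ := τ^1. -/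
open Matrix BigOperators Finset Filter

/-- Extend a `Fin N`-indexed matrix to `ℕ` indices by zero. -/
def matExt {R : Type*} [Zero R] {N : ℕ} (U : Matrix (Fin N) (Fin N) R) : ℕ → ℕ → R :=
  fun i j => if hi : i < N then (if hj : j < N then U ⟨i, hi⟩ ⟨j, hj⟩ else 0) else 0

/-- `U` is upper unitriangular. -/
def UpperUni {R : Type*} [Zero R] [One R] {N : ℕ} (U : Matrix (Fin N) (Fin N) R) : Prop :=
  (∀ i, U i i = 1) ∧ ∀ i j : Fin N, (j : ℕ) < (i : ℕ) → U i j = 0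

/-- `L` is lower unitriangular. -/
def LowerUni {R : Type*} [Zero R] [One R] {N : ℕ} (L : Matrix (Fin N) (Fin N) R) : Prop :=
  (∀ i, L i i = 1) ∧ ∀ i j : Fin N, (i : ℕ) < (j : ℕ) → L i j = 0

/-- 0-based entries of the Maya diagram `J(λ;r)` (the `a`-th smallest element, minus 1):
for `a = 0,…,r-1` this is `λ_{r-a} + a` (with `λ` 0-based). -/
def maya (lam : ℕ → ℕ) (r : ℕ) (a : Fin r) : ℕ := lam (r - 1 - (a : ℕ)) + (a : ℕ)

/-- The ninth variation of the skew Schur function `S^{(r)}_{λ/μ}(U)`: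
the minor of `U` on rows `J(μ;r)` and columns `J(λ;r)`. -/
def SchurV {R : Type*} [CommRing R] {N : ℕ} (U : Matrix (Fin N) (Fin N) R)
    (r : ℕ) (lam mu : ℕ → ℕ) : R :=
  Matrix.det (Matrix.of fun i j : Fin r => matExt U (maya mu r i) (maya lam r j))

/-- Conjugate partition (0-based), counting parts among indices `< B`. -/
def conjF (f : ℕ → ℕ) (B : ℕ) : ℕ → ℕ :=
  fun i => ((Finset.range B).filter fun j => i + 1 ≤ f j).card

/-- The hook partition `(a+1, 1^b)` (0-based function). -/
def hookP (a b : ℕ) : ℕ → ℕ := fun k => if k = 0 then a + 1 else if k ≤ b then 1 else 0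

/-- `h^{(r)}_d(U) = S^{(r)}_{(d)}(U)`, zero for `d < 0`. -/
def hSV {R : Type*} [CommRing R] {N : ℕ} (U : Matrix (Fin N) (Fin N) R) (r : ℕ) (d : ℤ) : R :=
  if 0 ≤ d then SchurV U r (fun k => if k = 0 then d.toNat else 0) (fun _ => 0) else 0

/-- `e^{(r)}_d(U) = S^{(r)}_{(1^d)}(U)`, zero for `d < 0`. -/
def eSV {R : Type*} [CommRing R] {N : ℕ} (U : Matrix (Fin N) (Fin N) R) (r : ℕ) (d : ℤ) : R :=
  if 0 ≤ d then SchurV U r (fun k => if k < d.toNat then 1 else 0) (fun _ => 0) else 0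

/-- The partition with Frobenius coordinates `(a|b)` (all 0-based as functions). -/
def frobP (p : ℕ) (a b : Fin p → ℕ) : ℕ → ℕ :=
  fun i => if h : i < p then a ⟨i, h⟩ + i + 1
    else (Finset.univ.filter fun j : Fin p => i < b j + (j : ℕ) + 1).card

/-- `f : ℕ → ℤ` is a partition of length `≤ B`. -/
def IsPartZ (B : ℕ) (f : ℕ → ℤ) : Prop :=
  (∀ i, f (i + 1) ≤ f i) ∧ (∀ i, 0 ≤ f i) ∧ (∀ i, B ≤ i → f i = 0)

/-- `lam/mu` is a skew partition (of length `≤ B`). -/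
def IsSkewZ (B : ℕ) (lam mu : ℕ → ℤ) : Prop :=
  IsPartZ B lam ∧ IsPartZ B mu ∧ ∀ i, mu i ≤ lam i

open Classical in
/-- `S^{(r)}_{λ/μ}(U)` with the convention that it is `0` if `λ/μ` is not a skew partition. -/
noncomputable def SchurVz {R : Type*} [CommRing R] {N : ℕ} (U : Matrix (Fin N) (Fin N) R)
    (r B : ℕ) (lam mu : ℕ → ℤ) : R :=
  if IsSkewZ B lam mu then SchurV U r (fun i => (lam i).toNat) (fun i => (mu i).toNat) else 0

open Classical in
/-- `S^{(r)}_{λ'/μ'}(U)` applied to the conjugates, with the zero convention. -/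
noncomputable def SchurVzConj {R : Type*} [CommRing R] {N : ℕ} (U : Matrix (Fin N) (Fin N) R)
    (r B : ℕ) (lam mu : ℕ → ℤ) : R :=
  if IsSkewZ B lam mu then
    SchurV U r (conjF (fun i => (lam i).toNat) B) (conjF (fun i => (mu i).toNat) B) else 0

/-- `lam/mu` is a skew partition (ℕ-valued version). -/
def IsSkewN (B : ℕ) (lam mu : ℕ → ℕ) : Prop :=
  (∀ i, lam (i + 1) ≤ lam i) ∧ (∀ i, mu (i + 1) ≤ mu i) ∧ (∀ i, mu i ≤ lam i) ∧
    (∀ i, B ≤ i → lam i = 0)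

open Classical in
noncomputable def SchurVn {R : Type*} [CommRing R] {N : ℕ} (U : Matrix (Fin N) (Fin N) R)
    (r B : ℕ) (lam mu : ℕ → ℕ) : R :=
  if IsSkewN B lam mu then SchurV U r lam mu else 0

/-- The rectangular partition `[m|n] = (n^m)`. -/
def rectP (m n : ℕ) : ℕ → ℕ := fun i => if i < m then n else 0

/-- `[m|n]^l = ((n+1)^l, n^{m-l})`. -/
def rectUpP (m n l : ℕ) : ℕ → ℕ := fun i => if i < l then n + 1 else if i < m then n else 0

/-- `[m|n]_k = (n^m, k)`. -/
def rectLowP (m n k : ℕ) : ℕ → ℕ := fun i => if i < m then n else if i = m then k else 0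

/-- `E + c·E_{t,t+1}` (indices 0-based). -/
def elemMat {R : Type*} [CommRing R] (N t : ℕ) (c : R) : Matrix (Fin N) (Fin N) R :=
  1 + Matrix.of (fun i j : Fin N => if (i : ℕ) = t ∧ (j : ℕ) = t + 1 then c else 0)

/-- `U = U_1 ⋯ U_M` with `U_k = (E + w_{k,1-r}E_{1,2}) ⋯ (E + w_{k,N-1-r}E_{N-1,N})`. -/
def UmatW {R : Type*} [CommRing R] (N M : ℕ) (r : ℤ) (w : ℕ → ℤ → R) :
    Matrix (Fin N) (Fin N) R :=
  ((List.range M).map fun k =>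
    ((List.range (N - 1)).map fun t => elemMat N t (w (k + 1) ((t : ℤ) + 1 - r))).prod).prod

/-- The partition `(m_1^{r_1} m_2^{r_2-r_1} ⋯ m_n^{r_n-r_{n-1}})` (corner data 0-based). -/
def stepPart (n : ℕ) (m rr : ℕ → ℕ) : ℕ → ℕ :=
  fun i =>
    if h : (((Finset.range n).filter fun j => i < rr j)).Nonempty then
      m (((Finset.range n).filter fun j => i < rr j).min' h)
    else 0

/-- `Add_{a,b}` (rows 1-based in `a`, `b`; the function argument is 0-based). -/
def AddOp (a b : ℕ) (k : ℕ → ℕ) : ℕ → ℕ := fun i =>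
  if i + 1 ≤ a then k i
  else if i + 1 = a + 1 then k (a - 1)
  else if i + 1 ≤ b + 1 then k (i - 1) + 1
  else k i

/-- `Rem_{a,b}`. -/
def RemOp (a b : ℕ) (k : ℕ → ℕ) : ℕ → ℕ := fun i =>
  if i + 1 < a then k i
  else if i + 1 ≤ b - 1 then k (i + 1) - 1
  else if i + 1 = b then k b
  else k i

/-- `op_{a 0, b 0} ∘ op_{a 1, b 1} ∘ ⋯ ∘ op_{a (t-1), b (t-1)}` applied to `k`. -/
def iterOp (op : ℕ → ℕ → (ℕ → ℕ) → ℕ → ℕ) (t : ℕ) (a b : ℕ → ℕ) (k : ℕ → ℕ) : ℕ → ℕ :=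
  (List.range t).foldr (fun i acc => op (a i) (b i) acc) k

/-- the `i`-th smallest element of a finite set of naturals (0-based). -/
def ascNth (s : Finset ℕ) (i : ℕ) : ℕ := (s.sort (· ≤ ·)).getD i 0

/-- The cells of the skew Young diagram `D(λ/μ)` (0-based, rows `< B`). -/
def cellsD (B : ℕ) (lam mu : ℕ → ℕ) : Finset (ℕ × ℕ) :=
  (Finset.range B ×ˢ Finset.range (lam 0 + 1)).filter fun p => mu p.1 ≤ p.2 ∧ p.2 < lam p.1

/-- Semistandardness: weakly increasing along rows, strictly increasing down columns. -/
def IsSSYT {M B : ℕ} {lam mu : ℕ → ℕ} (T : ↥(cellsD B lam mu) → Fin M) : Prop :=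
  (∀ c c' : ↥(cellsD B lam mu), c.val.1 = c'.val.1 → c.val.2 ≤ c'.val.2 → T c ≤ T c') ∧
  (∀ c c' : ↥(cellsD B lam mu), c.val.1 < c'.val.1 → c.val.2 = c'.val.2 → T c < T c')

open Classical in
/-- Sum over all semistandard tableaux of shape `λ/μ` with entries in `{1,…,M}` of
the product over cells `c` of `f (entry) c`. -/
noncomputable def tabSum {R : Type*} [CommRing R] (M B : ℕ) (lam mu : ℕ → ℕ)
    (f : ℕ → ℕ × ℕ → R) : R :=
  ∑ T ∈ Finset.univ.filter (fun T : ↥(cellsD B lam mu) → Fin M => IsSSYT T),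
    ∏ c : ↥(cellsD B lam mu), f ((T c : ℕ) + 1) c.val

/-- `M`-truncated Schur multiple zeta value for a general filling `s` of the diagram. -/
noncomputable def zetaTF (M B : ℕ) (lam mu : ℕ → ℕ) (s : ℕ × ℕ → ℂ) : ℂ :=
  tabSum M B lam mu fun k c => (k : ℂ) ^ (-(s c))

/-- `M`-truncated diagonally constant Schur multiple zeta value `ζ^M_{λ/μ}(a)`. -/
noncomputable def zetaT (M B : ℕ) (lam mu : ℕ → ℕ) (a : ℤ → ℂ) : ℂ :=
  zetaTF M B lam mu fun c => a ((c.2 : ℤ) - (c.1 : ℤ))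

open Classical in
/-- `ζ^M_{λ/μ}(a)` with the zero convention for non-skew shapes. -/
noncomputable def zetaZ (M B : ℕ) (lam mu : ℕ → ℤ) (a : ℤ → ℂ) : ℂ :=
  if IsSkewZ B lam mu then
    zetaT M B (fun i => (lam i).toNat) (fun i => (mu i).toNat) a else 0

open Classical in
/-- `ζ^M_{λ'/μ'}(a)` applied to conjugates, with the zero convention. -/
noncomputable def zetaZConj (M B : ℕ) (lam mu : ℕ → ℤ) (a : ℤ → ℂ) : ℂ :=
  if IsSkewZ B lam mu then
    zetaT M (lam 0).toNat (conjF (fun i => (lam i).toNat) B)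
      (conjF (fun i => (mu i).toNat) B) a
  else 0

open Classical in
/-- `M`-truncated multiple zeta-star value `ζ^{⋆,M}(s_0,…,s_{d-1})`. -/
noncomputable def zetaStarT (M d : ℕ) (s : ℕ → ℂ) : ℂ :=
  ∑ f ∈ Finset.univ.filter (fun f : Fin d → Fin M => ∀ i j : Fin d, i ≤ j → f i ≤ f j),
    ∏ i : Fin d, (((f i : ℕ) + 1 : ℕ) : ℂ) ^ (-(s i))

open Classical in
/-- `M`-truncated multiple zeta value `ζ^{M}(s_0,…,s_{d-1})`. -/
noncomputable def zetaMT (M d : ℕ) (s : ℕ → ℂ) : ℂ :=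
  ∑ f ∈ Finset.univ.filter (fun f : Fin d → Fin M => ∀ i j : Fin d, i < j → f i < f j),
    ∏ i : Fin d, (((f i : ℕ) + 1 : ℕ) : ℂ) ^ (-(s i))

/-- The Riemann zeta value `ζ(k) = Σ_{n ≥ 1} n^{-k}`. -/
noncomputable def zetaVal (k : ℕ) : ℂ := ∑' n : ℕ, ((n + 1 : ℕ) : ℂ) ^ (-(k : ℤ))

/-- `ζ^⋆(1,k) = Σ_{1 ≤ m ≤ n} m^{-1} n^{-k}`. -/
noncomputable def zetaStarOne (k : ℕ) : ℂ :=
  ∑' n : ℕ, (∑ m ∈ Finset.Icc 1 (n + 1), ((m : ℂ))⁻¹) * ((n + 1 : ℕ) : ℂ) ^ (-(k : ℤ))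


namespace PluckerAux

/-- Semistandardness on an arbitrary finite set of cells. -/
def SS (D : Finset (ℕ × ℕ)) {M : ℕ} (T : ↥D → Fin M) : Prop :=
  (∀ c c' : ↥D, c.val.1 = c'.val.1 → c.val.2 ≤ c'.val.2 → T c ≤ T c') ∧
  (∀ c c' : ↥D, c.val.1 < c'.val.1 → c.val.2 = c'.val.2 → T c < T c')

open Classical in
noncomputable def G (D : Finset (ℕ × ℕ)) (M : ℕ) (f : ℕ → ℕ × ℕ → ℂ) : ℂ :=
  ∑ T ∈ Finset.univ.filter (fun T : ↥D → Fin M => SS D T),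
    ∏ c : ↥D, f ((T c : ℕ) + 1) c.val

theorem tabSum_eq_G (M B : ℕ) (lam mu : ℕ → ℕ) (f : ℕ → ℕ × ℕ → ℂ) :
    tabSum M B lam mu f = G (cellsD B lam mu) M f := rfl

/-- cells of the shape whose column lengths are `κ 0, …, κ (N-1)` -/
def D (κ : ℕ → ℕ) (N : ℕ) : Finset (ℕ × ℕ) :=
  (Finset.range (κ 0) ×ˢ Finset.range N).filter fun c => c.1 < κ c.2

theorem mem_D {κ : ℕ → ℕ} (hκ : Antitone κ) {N : ℕ} {c : ℕ × ℕ} :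
    c ∈ D κ N ↔ c.2 < N ∧ c.1 < κ c.2 := by
  have := hκ (Nat.zero_le c.2)
  simp only [D, Finset.mem_filter, Finset.mem_product, Finset.mem_range]
  constructor
  · rintro ⟨⟨_, h⟩, h'⟩; exact ⟨h, h'⟩
  · rintro ⟨h, h'⟩; exact ⟨⟨by omega, h⟩, h'⟩

/-- remove the bottom cell from each column in `s` -/
def sub (κ : ℕ → ℕ) (s : Finset ℕ) : ℕ → ℕ := fun j => if j ∈ s then κ j - 1 else κ j

def Valid (κ : ℕ → ℕ) (s : Finset ℕ) : Prop := ∀ j ∈ s, κ (j + 1) = κ j → j + 1 ∈ s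

theorem Valid.pos {κ : ℕ → ℕ} {s : Finset ℕ} {N : ℕ} (hκ : Antitone κ)
    (hs : s ⊆ Finset.range N) (h : Valid κ s) {j : ℕ} (hj : j ∈ s) : 0 < κ j := by
  by_contra h0
  have h0 : κ j = 0 := by omega
  have key : ∀ k, j + k ∈ s := by
    intro k
    induction k with
    | zero => exact hj
    | succ k ih =>
      refine h _ ih ?_
      change κ (j + k + 1) = κ (j + k)
      have h1 := hκ (show j ≤ j + k by omega)
      have h2 := hκ (show j ≤ j + k + 1 by omega)
      omega
  have := Finset.mem_range.1 (hs (key N))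
  omega

theorem Valid.antitone {κ : ℕ → ℕ} {s : Finset ℕ} (hκ : Antitone κ)
    (h : Valid κ s) : Antitone (sub κ s) := by
  refine antitone_nat_of_succ_le fun j => ?_
  have h1 := hκ (Nat.le_succ j)
  have h2 := h j
  simp only [Nat.succ_eq_add_one] at h1
  simp only [sub]
  split_ifs with a b b
  · omega
  · omega
  · have := mt (h2 b) a
    omega
  · omega

theorem G_zero_of_empty (f) (D : Finset (ℕ × ℕ)) (h : D = ∅) : G D 0 f = 1 := by
  subst h
  simp only [G]
  rw [Finset.sum_eq_card_nsmul (b := 1)]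
  · convert (one_smul ℕ (1:ℂ))
    rw [show (1:ℕ) = Fintype.card (↥(∅ : Finset (ℕ × ℕ)) → Fin 0) by simp]
    rw [← Finset.card_univ]
    congr 1
    ext T; simp [SS]
  · intros; simp

theorem G_zero_of_nonempty (f) (D : Finset (ℕ × ℕ)) (h : D.Nonempty) : G D 0 f = 0 := by
  obtain ⟨c, hc⟩ := h
  apply Finset.sum_eq_zero
  intro T
  exact (T ⟨c, hc⟩).elim0

open Classical in
/-- columns whose bottom entry is the maximal one -/
noncomputable def sig (κ : ℕ → ℕ) (N M : ℕ) (T : ↥(D κ N) → Fin (M + 1)) : Finset ℕ :=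
  (Finset.range N).filter fun j => ∃ h : (κ j - 1, j) ∈ D κ N, T ⟨_, h⟩ = Fin.last M

theorem sig_valid {κ : ℕ → ℕ} (hκ : Antitone κ) {N M : ℕ} (hN : ∀ j, N ≤ j → κ j = 0)
    {T : ↥(D κ N) → Fin (M + 1)} (hT : SS _ T) : Valid κ (sig κ N M T) := by
  intro j hj hk
  simp only [sig, Finset.mem_filter, Finset.mem_range] at hj ⊢
  obtain ⟨h1, h2, h3⟩ := hj
  have h4 := (mem_D hκ).1 h2
  simp only at h4
  have h5 : j + 1 < N := by
    by_contra hh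
    have := hN (j + 1) (by omega)
    omega
  have h6 : (κ (j + 1) - 1, j + 1) ∈ D κ N := (mem_D hκ).2 ⟨h5, by simp only; omega⟩
  refine ⟨h5, h6, ?_⟩
  have := hT.1 ⟨_, h2⟩ ⟨_, h6⟩ (by simp only; omega) (by simp)
  rw [h3] at this
  exact le_antisymm (Fin.le_last _) this

theorem lt_last {κ : ℕ → ℕ} (hκ : Antitone κ) {N M : ℕ}
    {T : ↥(D κ N) → Fin (M + 1)} (hT : SS _ T) (c : ↥(D κ N))
    (hc : c.val ∈ D (sub κ (sig κ N M T)) N) (hs : Antitone (sub κ (sig κ N M T))) :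
    (T c : ℕ) < M := by
  obtain ⟨⟨i, j⟩, hcD⟩ := c
  have h1 := (mem_D hκ).1 hcD
  have h2 := (mem_D hs).1 hc
  simp only at h1 h2
  have hb : (κ j - 1, j) ∈ D κ N := (mem_D hκ).2 ⟨h1.1, by simp only; omega⟩
  have hle := Nat.lt_succ_iff.1 (T ⟨_, hcD⟩).2
  rcases Nat.lt_or_ge i (κ j - 1) with h | h
  · have := hT.2 ⟨_, hcD⟩ ⟨_, hb⟩ h rfl
    have h3 := Nat.lt_succ_iff.1 (T ⟨_, hb⟩).2
    have : (T ⟨_, hcD⟩ : ℕ) < (T ⟨_, hb⟩ : ℕ) := this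
    omega
  · have hi : i = κ j - 1 := by omega
    subst hi
    have hjs : j ∉ sig κ N M T := by
      intro hj
      rw [sub, if_pos hj] at h2
      omega
    rcases lt_or_eq_of_le hle with h4 | h4
    · exact h4
    · exfalso
      apply hjs
      simp only [sig, Finset.mem_filter, Finset.mem_range]
      exact ⟨h1.1, hcD, Fin.ext h4⟩

theorem D_sub_subset {κ : ℕ → ℕ} (hκ : Antitone κ) {N : ℕ} {s : Finset ℕ}
    (hv : Valid κ s) : D (sub κ s) N ⊆ D κ N := by
  intro c hc
  have := (mem_D (hv.antitone hκ)).1 hc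
  refine (mem_D hκ).2 ⟨this.1, ?_⟩
  have h2 := this.2
  simp only [sub] at h2
  split_ifs at h2 <;> omega

theorem not_mem_D_sub {κ : ℕ → ℕ} (hκ : Antitone κ) {N : ℕ} {s : Finset ℕ}
    (hv : Valid κ s) {c : ℕ × ℕ} (h1 : c ∈ D κ N) (h2 : c ∉ D (sub κ s) N) :
    c.2 ∈ s ∧ c.1 = κ c.2 - 1 := by
  rw [mem_D hκ] at h1
  rw [mem_D (hv.antitone hκ)] at h2
  simp only [sub] at h2
  split_ifs at h2 with h
  · exact ⟨h, by omega⟩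
  · exact absurd h1 h2

theorem bot_not_mem {κ : ℕ → ℕ} (hκ : Antitone κ) {N : ℕ} {s : Finset ℕ}
    (hv : Valid κ s) {j : ℕ} (hj : j ∈ s) : (κ j - 1, j) ∉ D (sub κ s) N := by
  rw [mem_D (hv.antitone hκ)]
  simp [sub, hj]

theorem D_eq_union {κ : ℕ → ℕ} (hκ : Antitone κ) {N : ℕ} {s : Finset ℕ}
    (hs : s ⊆ Finset.range N) (hv : Valid κ s) :
    D κ N = D (sub κ s) N ∪ s.image (fun j => (κ j - 1, j)) := by
  ext c
  rw [Finset.mem_union, Finset.mem_image]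
  constructor
  · intro h
    by_cases h2 : c ∈ D (sub κ s) N
    · exact Or.inl h2
    · have := not_mem_D_sub hκ hv h h2
      exact Or.inr ⟨c.2, this.1, by rw [← this.2]⟩
  · rintro (h | ⟨j, hj, rfl⟩)
    · exact D_sub_subset hκ hv h
    · refine (mem_D hκ).2 ⟨Finset.mem_range.1 (hs hj), ?_⟩
      have := hv.pos hκ hs hj
      simp only; omega

/-- extend a tableau by the maximal entry -/
def extT {M : ℕ} {D' D : Finset (ℕ × ℕ)} (T : ↥D' → Fin M) (c : ↥D) : Fin (M + 1) :=
  if h : c.val ∈ D' then (T ⟨c.val, h⟩).castSucc else Fin.last M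

theorem extT_SS {κ : ℕ → ℕ} (hκ : Antitone κ) {N M : ℕ} {s : Finset ℕ}
    (hv : Valid κ s) {T : ↥(D (sub κ s) N) → Fin M} (hT : SS _ T) :
    SS (D κ N) (extT (D := D κ N) T) := by
  have hanti := hv.antitone hκ
  constructor
  · intro c c' h1 h2
    unfold extT
    by_cases hc' : c'.val ∈ D (sub κ s) N
    · have hc : c.val ∈ D (sub κ s) N := by
        rw [mem_D hanti] at hc' ⊢
        have := hanti h2
        omega
      rw [dif_pos hc, dif_pos hc']
      exact Fin.castSucc_le_castSucc_iff.2 (hT.1 _ _ h1 h2)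
    · rw [dif_neg hc']; exact Fin.le_last _
  · intro c c' h1 h2
    unfold extT
    have hc : c.val ∈ D (sub κ s) N := by
      rw [mem_D hanti]
      have h3 := (mem_D hκ).1 c'.2
      rw [h2]
      refine ⟨h3.1, ?_⟩
      have := h3.2
      simp only [sub]
      split_ifs <;> omega
    rw [dif_pos hc]
    split_ifs with hc'
    · exact Fin.castSucc_lt_castSucc_iff.2 (hT.2 _ _ h1 h2)
    · exact Fin.castSucc_lt_last _

theorem sig_extT {κ : ℕ → ℕ} (hκ : Antitone κ) {N M : ℕ} {s : Finset ℕ}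
    (hs : s ⊆ Finset.range N)
    (hv : Valid κ s) (T : ↥(D (sub κ s) N) → Fin M) :
    sig κ N M (extT (D := D κ N) T) = s := by
  ext j
  simp only [sig, Finset.mem_filter, Finset.mem_range]
  constructor
  · rintro ⟨h1, h2, h3⟩
    unfold extT at h3
    split_ifs at h3 with h4
    · exact absurd h3 (Fin.castSucc_lt_last _).ne
    · exact (not_mem_D_sub hκ hv h2 h4).1
  · intro hj
    have hjN := Finset.mem_range.1 (hs hj)
    have := hv.pos hκ hs hj
    refine ⟨hjN, (mem_D hκ).2 ⟨hjN, by simp only; omega⟩, ?_⟩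
    unfold extT
    rw [dif_neg (bot_not_mem hκ hv hj)]

theorem G_fiber {κ : ℕ → ℕ} (hκ : Antitone κ) {N M : ℕ} (f : ℕ → ℕ × ℕ → ℂ) {s : Finset ℕ}
    (hs : s ⊆ Finset.range N) (hv : Valid κ s) [DecidablePred fun T : ↥(D κ N) → Fin (M + 1) =>
      SS _ T ∧ sig κ N M T = s] :
    ∑ T ∈ Finset.univ.filter (fun T : ↥(D κ N) → Fin (M + 1) => SS _ T ∧ sig κ N M T = s),
      ∏ c : ↥(D κ N), f ((T c : ℕ) + 1) c.val =
    G (D (sub κ s) N) M f * ∏ j ∈ s, f (M + 1) (κ j - 1, j) := by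
  classical
  rw [G, Finset.sum_mul]
  symm
  have hanti := hv.antitone hκ
  refine Finset.sum_bij (fun T _ => extT (D := D κ N) T) ?_ ?_ ?_ ?_
  · intro T hT
    simp only [Finset.mem_filter, Finset.mem_univ, true_and] at hT ⊢
    exact ⟨extT_SS hκ hv hT, sig_extT hκ hs hv T⟩
  · intro T _ T' _ h
    funext c
    have := congrFun h ⟨c.val, D_sub_subset hκ hv c.2⟩
    unfold extT at this
    rw [dif_pos c.2, dif_pos c.2] at this
    exact Fin.castSucc_injective _ this
  · intro T hT
    simp only [Finset.mem_filter, Finset.mem_univ, true_and] at hT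
    obtain ⟨hT, hsig⟩ := hT
    subst hsig
    refine ⟨fun c => ⟨T ⟨c.val, D_sub_subset hκ hv c.2⟩, lt_last hκ hT _ c.2 hanti⟩, ?_, ?_⟩
    · simp only [Finset.mem_filter, Finset.mem_univ, true_and]
      constructor
      · intro c c' h1 h2
        exact hT.1 ⟨c.val, D_sub_subset hκ hv c.2⟩ ⟨c'.val, D_sub_subset hκ hv c'.2⟩ h1 h2
      · intro c c' h1 h2
        exact hT.2 ⟨c.val, D_sub_subset hκ hv c.2⟩ ⟨c'.val, D_sub_subset hκ hv c'.2⟩ h1 h2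
    · funext c
      unfold extT
      split_ifs with h
      · rfl
      · obtain ⟨h1, h2⟩ := not_mem_D_sub hκ hv c.2 h
        simp only [sig, Finset.mem_filter, Finset.mem_range] at h1
        obtain ⟨_, h3, h4⟩ := h1
        rw [← h4]
        congr 1
        exact Subtype.ext (Prod.ext h2.symm rfl)
  · intro T hT
    set F : ℕ × ℕ → ℂ := fun c =>
      f ((if h : c ∈ D (sub κ s) N then (T ⟨c, h⟩ : ℕ) else M) + 1) c with hF
    have e1 : ∏ c : ↥(D κ N), f ((extT (D := D κ N) T c : ℕ) + 1) c.val = ∏ c ∈ D κ N, F c := by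
      rw [← Finset.prod_coe_sort (D κ N) F]
      refine Finset.prod_congr rfl fun c _ => ?_
      simp only [hF, extT]
      split_ifs <;> rfl
    have e2 : ∏ c : ↥(D (sub κ s) N), f ((T c : ℕ) + 1) c.val = ∏ c ∈ D (sub κ s) N, F c := by
      rw [← Finset.prod_coe_sort (D (sub κ s) N) F]
      refine Finset.prod_congr rfl fun c _ => ?_
      simp only [hF]
      rw [dif_pos c.2]
    rw [e1, e2, D_eq_union hκ hs hv, Finset.prod_union, Finset.prod_image]
    · congr 1
      refine Finset.prod_congr rfl fun j hj => ?_
      simp only [hF]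
      rw [dif_neg (bot_not_mem hκ hv hj)]
    · intro j _ j' _ h
      exact (Prod.ext_iff.1 h).2
    · rw [Finset.disjoint_right]
      intro c hc
      obtain ⟨j, hj, rfl⟩ := Finset.mem_image.1 hc
      exact bot_not_mem hκ hv hj

open Classical in
theorem G_succ {κ : ℕ → ℕ} (hκ : Antitone κ) {N : ℕ} (hN : ∀ j, N ≤ j → κ j = 0)
    (M : ℕ) (f : ℕ → ℕ × ℕ → ℂ) :
    G (D κ N) (M + 1) f = ∑ s ∈ (Finset.range N).powerset,
      if Valid κ s then G (D (sub κ s) N) M f * ∏ j ∈ s, f (M + 1) (κ j - 1, j) else 0 := by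
  rw [G, ← Finset.sum_fiberwise_of_maps_to (t := (Finset.range N).powerset) (g := sig κ N M)]
  · refine Finset.sum_congr rfl fun s hs => ?_
    rw [Finset.mem_powerset] at hs
    rw [Finset.filter_filter]
    split_ifs with hv
    · exact G_fiber hκ f hs hv
    · apply Finset.sum_eq_zero
      intro T hT
      simp only [Finset.mem_filter, Finset.mem_univ, true_and] at hT
      exact absurd (hT.2 ▸ sig_valid hκ hN hT.1) hv
  · intro T _
    exact Finset.mem_powerset.2 (Finset.filter_subset _ _)

/-- the path-generating functions: column generating function with contents `q, q-1, …, p+1`. -/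
noncomputable def V (w : ℕ → ℤ → ℂ) : ℕ → ℤ → ℤ → ℂ
  | 0, p, q => if p = q then 1 else 0
  | M + 1, p, q => V w M p q + w (M + 1) (p + 1) * V w M (p + 1) q

theorem V_lt (w : ℕ → ℤ → ℂ) (M : ℕ) : ∀ p q : ℤ, q < p → V w M p q = 0 := by
  induction M with
  | zero => intro p q h; simp only [V]; rw [if_neg (by omega)]
  | succ M ih => intro p q h; simp only [V]; rw [ih _ _ h, ih _ _ (by omega)]; simp

theorem V_shift (w : ℕ → ℤ → ℂ) (M : ℕ) : ∀ p q : ℤ,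
    V (fun k c => w k (c + 1)) M p q = V w M (p + 1) (q + 1) := by
  induction M with
  | zero => intro p q; simp [V]
  | succ M ih => intro p q; simp only [V]; rw [ih, ih]

theorem det_expand {n : ℕ} (m m' : Matrix (Fin n) (Fin n) ℂ) (c : Fin n → ℂ) :
    Matrix.det (Matrix.of fun j i => m j i + c j * m' j i) =
      ∑ s : Finset (Fin n), (∏ j ∈ s, c j) *
        Matrix.det (Matrix.of fun j i => if j ∈ s then m' j i else m j i) := by
  have h := (Matrix.detRowAlternating (R := ℂ) (n := Fin n)).map_add_univ
    (fun j i => c j * m' j i) (fun j i => m j i)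
  have e1 : Matrix.det (Matrix.of fun j i => m j i + c j * m' j i) =
    (Matrix.detRowAlternating (R := ℂ) (n := Fin n))
      ((fun j i => c j * m' j i) + (fun j i => m j i)) := by
    change _ = Matrix.det _
    congr 1
    ext j i
    simp [add_comm]
  rw [e1, h]
  refine Finset.sum_congr rfl fun s _ => ?_
  have e2 := (Matrix.detRowAlternating (R := ℂ) (n := Fin n)).toMultilinearMap.map_piecewise_smul
    c (fun j i => if j ∈ s then m' j i else m j i) s
  rw [smul_eq_mul] at e2
  refine Eq.trans ?_ e2
  change Matrix.det _ = Matrix.det _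
  congr 1
  funext j i
  by_cases hj : j ∈ s <;> simp [Finset.piecewise, hj]

theorem sum_powerset_range {n : ℕ} (g : Finset ℕ → ℂ) :
    ∑ s ∈ (Finset.range n).powerset, g s =
      ∑ s : Finset (Fin n), g (s.map Fin.valEmbedding) := by
  symm
  refine Finset.sum_bij (fun s _ => s.map Fin.valEmbedding) ?_ ?_ ?_ ?_
  · intro s _
    rw [Finset.mem_powerset]
    intro j hj
    obtain ⟨i, _, rfl⟩ := Finset.mem_map.1 hj
    exact Finset.mem_range.2 i.2
  · intro s _ s' _ h
    exact Finset.map_injective _ h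
  · intro s hs
    rw [Finset.mem_powerset] at hs
    refine ⟨Finset.univ.filter (fun i : Fin n => (i : ℕ) ∈ s), Finset.mem_univ _, ?_⟩
    ext j
    simp only [Finset.mem_map, Finset.mem_filter, Finset.mem_univ, true_and,
      Fin.valEmbedding_apply]
    constructor
    · rintro ⟨i, hi, rfl⟩; exact hi
    · intro hj; exact ⟨⟨j, Finset.mem_range.1 (hs hj)⟩, hj, rfl⟩
  · intros; rfl

/-- dual Jacobi–Trudi determinant -/
noncomputable def JT (w : ℕ → ℤ → ℂ) (κ : ℕ → ℕ) (N M : ℕ) : ℂ :=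
  Matrix.det (Matrix.of fun j i : Fin N => V w M ((j : ℕ) - (κ j : ℤ)) (i : ℕ))

open Classical in
theorem JT_succ (w : ℕ → ℤ → ℂ) {κ : ℕ → ℕ} (hκ : Antitone κ) {N : ℕ}
    (hN : ∀ j, N ≤ j → κ j = 0) (M : ℕ) :
    JT w κ N (M + 1) = ∑ s ∈ (Finset.range N).powerset,
      if Valid κ s then JT w (sub κ s) N M *
        ∏ j ∈ s, w (M + 1) (((j : ℕ) : ℤ) - ((κ j - 1 : ℕ) : ℤ)) else 0 := by
  rw [sum_powerset_range, JT]
  simp only [V]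
  refine Eq.trans (det_expand (fun j i : Fin N => V w M ((j : ℕ) - (κ j : ℤ)) (i : ℕ))
    (fun j i : Fin N => V w M ((j : ℕ) - (κ j : ℤ) + 1) (i : ℕ))
    (fun j => w (M + 1) ((j : ℕ) - (κ j : ℤ) + 1))) ?_
  refine Finset.sum_congr rfl fun s _ => ?_
  have hs : s.map Fin.valEmbedding ⊆ Finset.range N := by
    intro j hj
    obtain ⟨i, _, rfl⟩ := Finset.mem_map.1 hj
    exact Finset.mem_range.2 i.2
  have hmem : ∀ j : Fin N, (j : ℕ) ∈ s.map Fin.valEmbedding ↔ j ∈ s := by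
    intro j
    simp [Fin.val_inj]
  split_ifs with hv
  · rw [mul_comm, Finset.prod_map]
    congr 1
    · unfold JT
      congr 1
      ext j i
      simp only [Matrix.of_apply, sub, hmem]
      split_ifs with h
      · have := hv.pos hκ hs ((hmem j).2 h)
        congr 1
        omega
      · rfl
    · refine Finset.prod_congr rfl fun j hj => ?_
      have := hv.pos hκ hs ((hmem j).2 hj)
      simp only [Fin.valEmbedding_apply]
      congr 1
      omega
  · simp only [Valid, not_forall] at hv
    obtain ⟨j, hj, hk, hj1⟩ := hv
    have hjN := Finset.mem_range.1 (hs hj)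
    have hjs : (⟨j, hjN⟩ : Fin N) ∈ s := (hmem ⟨j, hjN⟩).1 hj
    apply mul_eq_zero_of_right
    by_cases h : j + 1 < N
    · have hjs1 : (⟨j + 1, h⟩ : Fin N) ∉ s := fun h' => hj1 ((hmem ⟨j + 1, h⟩).2 h')
      refine Matrix.det_zero_of_row_eq (i := ⟨j, hjN⟩) (j := ⟨j + 1, h⟩) (by simp) ?_
      funext i
      simp only [Matrix.of_apply, hjs, hjs1, if_true, if_false]
      congr 1
      rw [hk]; push_cast; ring
    · refine Matrix.det_eq_zero_of_row_eq_zero ⟨j, hjN⟩ fun i => ?_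
      simp only [Matrix.of_apply, hjs, if_true]
      apply V_lt
      have := hN (j + 1) (by omega)
      have := i.2
      omega

theorem G_eq_JT (w : ℕ → ℤ → ℂ) {N : ℕ} (M : ℕ) : ∀ {κ : ℕ → ℕ} (_ : Antitone κ)
    (_ : ∀ j, N ≤ j → κ j = 0),
    G (D κ N) M (fun k c => w k ((c.2 : ℤ) - (c.1 : ℤ))) = JT w κ N M := by
  induction M with
  | zero =>
    intro κ hκ hN
    by_cases h : κ 0 = 0
    · have h0 : ∀ j, κ j = 0 := fun j => by have := hκ (Nat.zero_le j); omega
      rw [G_zero_of_empty]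
      · unfold JT
        symm
        convert Matrix.det_one (n := Fin N) (R := ℂ)
        ext j i
        simp [V, h0, Matrix.one_apply, Fin.ext_iff]
      · rw [Finset.eq_empty_iff_forall_notMem]
        intro c hc
        have := ((mem_D hκ).1 hc).2
        rw [h0] at this
        omega
    · have hN0 : 0 < N := by
        by_contra h'
        exact h (hN 0 (by omega))
      rw [G_zero_of_nonempty]
      · unfold JT
        symm
        refine Matrix.det_eq_zero_of_row_eq_zero ⟨0, hN0⟩ fun i => ?_
        simp only [Matrix.of_apply, V]
        rw [if_neg]
        have := i.2
        omega
      · exact ⟨(0, 0), (mem_D hκ).2 ⟨hN0, by simp only; omega⟩⟩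
  | succ M ih =>
    intro κ hκ hN
    rw [G_succ hκ hN, JT_succ w hκ hN]
    refine Finset.sum_congr rfl fun s hs => ?_
    split_ifs with hv
    · rw [ih (hv.antitone hκ)]
      intro j hj
      simp only [sub]
      split_ifs
      · rw [hN j hj]
      · exact hN j hj
    · rfl

theorem lt_conjF {κ : ℕ → ℕ} (hκ : Antitone κ) {N i j : ℕ} :
    j < conjF κ N i ↔ j < N ∧ i < κ j := by
  unfold conjF
  constructor
  · intro h
    constructor
    · have := (Finset.card_filter_le (Finset.range N) (fun j => i + 1 ≤ κ j))
      rw [Finset.card_range] at this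
      omega
    · by_contra h'
      have : (Finset.range N).filter (fun j => i + 1 ≤ κ j) ⊆ Finset.range j := by
        intro k hk
        rw [Finset.mem_filter] at hk
        rw [Finset.mem_range]
        by_contra h2
        have := hκ (show j ≤ k by omega)
        omega
      have := Finset.card_le_card this
      rw [Finset.card_range] at this
      omega
  · rintro ⟨h1, h2⟩
    have : Finset.range (j + 1) ⊆ (Finset.range N).filter (fun j => i + 1 ≤ κ j) := by
      intro k hk
      rw [Finset.mem_range] at hk
      rw [Finset.mem_filter, Finset.mem_range]
      have := hκ (show k ≤ j by omega)
      omega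
    have := Finset.card_le_card this
    rw [Finset.card_range] at this
    omega

theorem cellsD_eq {κ : ℕ → ℕ} (hκ : Antitone κ) {N B : ℕ} (hB : κ 0 ≤ B) :
    cellsD B (conjF κ N) (fun _ => 0) = D κ N := by
  ext ⟨i, j⟩
  rw [mem_D hκ]
  simp only [cellsD, Finset.mem_filter, Finset.mem_product, Finset.mem_range, lt_conjF hκ]
  have h0 := hκ (Nat.zero_le j)
  constructor
  · tauto
  · intro h
    refine ⟨⟨by omega, ?_⟩, by omega, h⟩
    have : j < conjF κ N 0 := (lt_conjF hκ).2 ⟨h.1, by omega⟩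
    omega

theorem zetaT_eq {κ : ℕ → ℕ} (hκ : Antitone κ) {N B : ℕ} (hB : κ 0 ≤ B)
    (hN : ∀ j, N ≤ j → κ j = 0) (M : ℕ) (a : ℤ → ℂ) :
    zetaT M B (conjF κ N) (fun _ => 0) a = JT (fun k c => (k : ℂ) ^ (-(a c))) κ N M := by
  unfold zetaT zetaTF
  rw [tabSum_eq_G, cellsD_eq hκ hB, ← G_eq_JT _ M hκ hN]

theorem JT_stable {κ : ℕ → ℕ} (hκ : Antitone κ) {N : ℕ} (hN : ∀ j, N ≤ j → κ j = 0)
    (w : ℕ → ℤ → ℂ) (M : ℕ) : JT w κ N M = JT w κ (N + 1) M := by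
  rw [← G_eq_JT _ M hκ hN, ← G_eq_JT _ M hκ (fun j hj => hN j (by omega))]
  congr 1
  ext c
  rw [mem_D hκ, mem_D hκ]
  constructor
  · intro h; omega
  · intro h
    refine ⟨?_, h.2⟩
    by_contra h'
    have := hN c.2 (by omega)
    omega

section LinAlg

variable {K : ℕ}

/-- rows: left rows `x i`, right rows `y j`, those in `P`, `Q` moved to the other block. -/
def blk (x y : ℕ → Fin K → ℂ) (P Q : Finset ℕ) : Matrix (Fin K ⊕ Fin K) (Fin K ⊕ Fin K) ℂ :=
  Matrix.of (Sum.elim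
    (fun i : Fin K => if (i : ℕ) ∈ P then Sum.elim (0 : Fin K → ℂ) (x i) else
      Sum.elim (x i) (0 : Fin K → ℂ))
    (fun j : Fin K => if (j : ℕ) ∈ Q then Sum.elim (y j) (0 : Fin K → ℂ) else
      Sum.elim (0 : Fin K → ℂ) (y j)))

theorem blk_inl (x y : ℕ → Fin K → ℂ) (P Q : Finset ℕ) (i : Fin K) :
    blk x y P Q (Sum.inl i) = if (i : ℕ) ∈ P then Sum.elim (0 : Fin K → ℂ) (x i) else
      Sum.elim (x i) (0 : Fin K → ℂ) := rfl

theorem blk_inr (x y : ℕ → Fin K → ℂ) (P Q : Finset ℕ) (j : Fin K) :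
    blk x y P Q (Sum.inr j) = if (j : ℕ) ∈ Q then Sum.elim (y j) (0 : Fin K → ℂ) else
      Sum.elim (0 : Fin K → ℂ) (y j) := rfl

/-- determinant with rows `x 0, …, x (K-1)` -/
noncomputable def dt (x : ℕ → Fin K → ℂ) : ℂ := Matrix.det (Matrix.of fun i : Fin K => x i)

theorem blk_empty (x y : ℕ → Fin K → ℂ) : (blk x y ∅ ∅).det = dt x * dt y := by
  have : blk x y ∅ ∅ = Matrix.fromBlocks (Matrix.of fun i : Fin K => x i) 0 0
      (Matrix.of fun i : Fin K => y i) := by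
    ext (i | i) (j | j) <;> simp [blk]
  rw [this, Matrix.det_fromBlocks_zero₂₁]
  rfl

theorem det_zero_of_card {ι : Type*} [Fintype ι] [DecidableEq ι] (A : Matrix ι ι ℂ)
    (Z W : Finset ι) (h : ∀ i ∈ Z, ∀ j, j ∉ W → A i j = 0) (hc : W.card < Z.card) :
    A.det = 0 := by
  rw [← Matrix.det_transpose, Matrix.det_apply]
  refine Finset.sum_eq_zero fun σ _ => ?_
  have : ∃ i ∈ Z, σ i ∉ W := by
    by_contra hh
    push Not at hh
    have := Finset.card_le_card_of_injOn σ hh (σ.injective.injOn)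
    omega
  obtain ⟨i, hi, hw⟩ := this
  rw [Finset.prod_eq_zero (Finset.mem_univ i), smul_zero]
  exact h i hi _ hw

theorem card_filter_mem {P : Finset ℕ} (hP : P ⊆ Finset.range K) :
    (Finset.univ.filter fun i : Fin K => (i : ℕ) ∈ P).card = P.card := by
  rw [← Finset.card_map Fin.valEmbedding]
  congr 1
  ext j
  simp only [Finset.mem_map, Finset.mem_filter, Finset.mem_univ, true_and, Fin.valEmbedding_apply]
  constructor
  · rintro ⟨i, hi, rfl⟩; exact hi
  · intro hj; exact ⟨⟨j, Finset.mem_range.1 (hP hj)⟩, hj, rfl⟩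

theorem card_filter_not_mem {P : Finset ℕ} (hP : P ⊆ Finset.range K) :
    (Finset.univ.filter fun i : Fin K => ¬ (i : ℕ) ∈ P).card = K - P.card := by
  have := Finset.card_filter_add_card_filter_not (s := (Finset.univ : Finset (Fin K)))
    (fun i : Fin K => (i : ℕ) ∈ P)
  rw [card_filter_mem hP, Finset.card_univ, Fintype.card_fin] at this
  omega

theorem blk_card_ne (x y : ℕ → Fin K → ℂ) {P Q : Finset ℕ} (hP : P ⊆ Finset.range K)
    (hQ : Q ⊆ Finset.range K) (h : P.card ≠ Q.card) : (blk x y P Q).det = 0 := by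
  have cP := Finset.card_le_card hP
  have cQ := Finset.card_le_card hQ
  rw [Finset.card_range] at cP cQ
  rcases lt_or_gt_of_ne h with h | h
  · refine det_zero_of_card _
      ((Finset.univ.filter fun i : Fin K => ¬ (i : ℕ) ∈ P).disjSum
        (Finset.univ.filter fun i : Fin K => (i : ℕ) ∈ Q))
      ((Finset.univ : Finset (Fin K)).disjSum ∅) ?_ ?_
    · rintro (i | i) hi (j | j) hj
      · simp at hj
      · simp only [Finset.inl_mem_disjSum, Finset.mem_filter] at hi
        simp [blk, hi.2]
      · simp at hj
      · simp only [Finset.inr_mem_disjSum, Finset.mem_filter] at hi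
        simp [blk, hi.2]
    · rw [Finset.card_disjSum, Finset.card_disjSum, card_filter_mem hQ, card_filter_not_mem hP]
      simp
      omega
  · refine det_zero_of_card _
      ((Finset.univ.filter fun i : Fin K => (i : ℕ) ∈ P).disjSum
        (Finset.univ.filter fun i : Fin K => ¬ (i : ℕ) ∈ Q))
      ((∅ : Finset (Fin K)).disjSum Finset.univ) ?_ ?_
    · rintro (i | i) hi (j | j) hj
      · simp only [Finset.inl_mem_disjSum, Finset.mem_filter] at hi
        simp [blk, hi.2]
      · simp at hj
      · simp only [Finset.inr_mem_disjSum, Finset.mem_filter] at hi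
        simp [blk, hi.2]
      · simp at hj
    · rw [Finset.card_disjSum, Finset.card_disjSum, card_filter_mem hP, card_filter_not_mem hQ]
      simp
      omega

/-- doubled rows on `X`, `Y`. -/
def dbl (x y : ℕ → Fin K → ℂ) (X Y : Finset ℕ) : Matrix (Fin K ⊕ Fin K) (Fin K ⊕ Fin K) ℂ :=
  Matrix.fromBlocks (Matrix.of fun i : Fin K => x i)
    (Matrix.of fun i : Fin K => if (i : ℕ) ∈ X then x i else 0)
    (Matrix.of fun i : Fin K => if (i : ℕ) ∈ Y then y i else 0)
    (Matrix.of fun i : Fin K => y i)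

theorem dbl_expand (x y : ℕ → Fin K → ℂ) {X Y : Finset ℕ} (hX : X ⊆ Finset.range K)
    (hY : Y ⊆ Finset.range K) :
    (dbl x y X Y).det = ∑ P ∈ X.powerset, ∑ Q ∈ Y.powerset, (blk x y P Q).det := by
  classical
  set m : Fin K ⊕ Fin K → Fin K ⊕ Fin K → ℂ :=
    Sum.elim (fun i => Sum.elim 0 (x i)) (fun j => Sum.elim (y j) 0) with hm
  set m' : Fin K ⊕ Fin K → Fin K ⊕ Fin K → ℂ :=
    Sum.elim (fun i => Sum.elim (x i) 0) (fun j => Sum.elim 0 (y j)) with hm'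
  set ff : Finset ℕ → Finset ℕ → Finset (Fin K ⊕ Fin K) := fun P Q =>
    (Finset.univ.filter fun i : Fin K => (i : ℕ) ∈ P).disjSum
        (Finset.univ.filter fun i : Fin K => (i : ℕ) ∈ Q) with hff
  have hblk : ∀ P Q, Matrix.det (blk x y P Q) = Matrix.det (Matrix.of ((ff P Q).piecewise m m')) := by
    intro P Q
    congr 1
    ext (i | i) c
    · by_cases h : (i : ℕ) ∈ P <;> simp [hff, hm, hm', blk, Finset.piecewise, h]
    · by_cases h : (i : ℕ) ∈ Q <;> simp [hff, hm, hm', blk, Finset.piecewise, h]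
  have h := (Matrix.detRowAlternating (R := ℂ) (n := Fin K ⊕ Fin K)).toMultilinearMap.map_piecewise_add
    m m' (ff X Y)
  have e1 : (dbl x y X Y).det = (Matrix.detRowAlternating (R := ℂ) (n := Fin K ⊕ Fin K)).toMultilinearMap
      ((ff X Y).piecewise (m + m') m') := by
    change _ = Matrix.det (Matrix.of ((ff X Y).piecewise (m + m') m'))
    congr 1
    ext r c
    rw [Matrix.of_apply]
    rcases r with i | i
    · by_cases h : (i : ℕ) ∈ X
      · rw [Finset.piecewise_eq_of_mem _ _ _ (by simp [hff, h])]
        rcases c with c | c <;> simp [hm, hm', dbl, h]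
      · rw [Finset.piecewise_eq_of_notMem _ _ _ (by simp [hff, h])]
        rcases c with c | c <;> simp [hm', dbl, h]
    · by_cases h : (i : ℕ) ∈ Y
      · rw [Finset.piecewise_eq_of_mem _ _ _ (by simp [hff, h])]
        rcases c with c | c <;> simp [hm, hm', dbl, h]
      · rw [Finset.piecewise_eq_of_notMem _ _ _ (by simp [hff, h])]
        rcases c with c | c <;> simp [hm', dbl, h]
  rw [e1, h, ← Finset.sum_product']
  symm
  have hrec : ∀ (P : Finset ℕ), P ⊆ Finset.range K →
      (Finset.univ.filter fun i : Fin K => (i : ℕ) ∈ P).map Fin.valEmbedding = P := by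
    intro P hP
    ext j
    simp only [Finset.mem_map, Finset.mem_filter, Finset.mem_univ, true_and,
      Fin.valEmbedding_apply]
    constructor
    · rintro ⟨i, hi, rfl⟩; exact hi
    · intro hj; exact ⟨⟨j, Finset.mem_range.1 (hP hj)⟩, hj, rfl⟩
  refine Finset.sum_bij (fun PQ _ => ff PQ.1 PQ.2) ?_ ?_ ?_ ?_
  · rintro ⟨P, Q⟩ h
    simp only [Finset.mem_product, Finset.mem_powerset] at h ⊢
    rintro (i | i) hi
    · simp only [hff, Finset.inl_mem_disjSum, Finset.mem_filter, Finset.mem_univ, true_and] at hi ⊢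
      exact h.1 hi
    · simp only [hff, Finset.inr_mem_disjSum, Finset.mem_filter, Finset.mem_univ, true_and] at hi ⊢
      exact h.2 hi
  · rintro ⟨P, Q⟩ h ⟨P', Q'⟩ h' heq
    simp only [Finset.mem_product, Finset.mem_powerset] at h h'
    have e1 : (Finset.univ.filter fun i : Fin K => (i : ℕ) ∈ P) =
        (Finset.univ.filter fun i : Fin K => (i : ℕ) ∈ P') := by
      ext i
      have := congrArg (fun s => Sum.inl i ∈ s) heq
      simpa [hff] using this
    have e2 : (Finset.univ.filter fun i : Fin K => (i : ℕ) ∈ Q) =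
        (Finset.univ.filter fun i : Fin K => (i : ℕ) ∈ Q') := by
      ext i
      have := congrArg (fun s => Sum.inr i ∈ s) heq
      simpa [hff] using this
    have f1 := hrec P (h.1.trans hX)
    have f2 := hrec P' (h'.1.trans hX)
    have f3 := hrec Q (h.2.trans hY)
    have f4 := hrec Q' (h'.2.trans hY)
    rw [e1, f2] at f1
    rw [e2, f4] at f3
    rw [f1, f3]
  · intro s hs
    rw [Finset.mem_powerset] at hs
    refine ⟨((Finset.univ.filter fun i : Fin K => Sum.inl i ∈ s).map Fin.valEmbedding,
      (Finset.univ.filter fun i : Fin K => Sum.inr i ∈ s).map Fin.valEmbedding), ?_, ?_⟩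
    · simp only [Finset.mem_product, Finset.mem_powerset]
      constructor
      · intro j hj
        simp only [Finset.mem_map, Finset.mem_filter, Finset.mem_univ, true_and,
          Fin.valEmbedding_apply] at hj
        obtain ⟨i, hi, rfl⟩ := hj
        have := hs hi
        simpa [hff] using this
      · intro j hj
        simp only [Finset.mem_map, Finset.mem_filter, Finset.mem_univ, true_and,
          Fin.valEmbedding_apply] at hj
        obtain ⟨i, hi, rfl⟩ := hj
        have := hs hi
        simpa [hff] using this
    · ext (i | i) <;> simp [hff, Fin.val_inj]
  · rintro ⟨P, Q⟩ _
    exact hblk P Q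

theorem det_swap_neg {ι : Type*} [Fintype ι] [DecidableEq ι] (A B : Matrix ι ι ℂ) {p q : ι}
    (hpq : p ≠ q) (h1 : B p = A q) (h2 : B q = - A p) (h3 : ∀ r, r ≠ p → r ≠ q → B r = A r) :
    B.det = A.det := by
  have e : B = (A.submatrix (Equiv.swap p q) id).updateRow q
      ((-1 : ℂ) • (A.submatrix (Equiv.swap p q) id) q) := by
    ext r c
    by_cases hq : r = q
    · subst hq; simp [h2]
    · rw [Matrix.updateRow_ne hq]
      by_cases hp : r = p
      · subst hp; simp [h1]
      · simp [h3 r hp hq, Equiv.swap_apply_of_ne_of_ne hp hq]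
  rw [e, Matrix.det_updateRow_smul, Matrix.updateRow_eq_self, Matrix.det_permute,
    Equiv.Perm.sign_swap hpq]
  simp

/-- The result of the block exchange. -/
theorem dbl_det (x y : ℕ → Fin K → ℂ) (l : ℕ) (hl : l < K) :
    (dbl x y (Finset.Ico l K) (Finset.Icc 1 l)).det =
      dt (fun i => if i < l then y (i + 1) else x i) *
        dt (fun j => if 1 ≤ j ∧ j ≤ l then x (j - 1) else y j) := by
  classical
  -- the intermediate matrices
  set R : ℕ → Matrix (Fin K ⊕ Fin K) (Fin K ⊕ Fin K) ℂ := fun k => Matrix.of (Sum.elim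
    (fun i : Fin K => if (i : ℕ) < k then Sum.elim (y (i + 1)) 0 else
      if (i : ℕ) < l then Sum.elim (x i) (- x i) else Sum.elim (x i) 0)
    (fun j : Fin K => if 1 ≤ (j : ℕ) ∧ (j : ℕ) ≤ k then Sum.elim (- x (j - 1)) (x (j - 1)) else
      if 1 ≤ (j : ℕ) ∧ (j : ℕ) ≤ l then Sum.elim (y j) 0 else Sum.elim 0 (y j))) with hR
  have h0 : (dbl x y (Finset.Ico l K) (Finset.Icc 1 l)).det = (R 0).det := by
    have : R 0 = dbl x y (Finset.Ico l K) (Finset.Icc 1 l) * Matrix.fromBlocks 1 (-1) 0 1 := by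
      rw [dbl, Matrix.fromBlocks_multiply]
      ext (i | i) (j | j)
      · by_cases h : (i : ℕ) < l <;> simp [hR, h]
      · by_cases h : (i : ℕ) < l
        · have : ¬ l ≤ (i : ℕ) := by omega
          simp [hR, h, this]
        · have : l ≤ (i : ℕ) := by omega
          simp [hR, h, this]
      · by_cases h : 1 ≤ (i : ℕ) ∧ (i : ℕ) ≤ l
        · have h' : 1 ≤ (i : ℕ) := h.1
          have : ¬ (i : ℕ) = 0 := by omega
          have : ¬ i = (⟨0, by omega⟩ : Fin K) := by simp [Fin.ext_iff]; omega
          simp only [hR, Matrix.of_apply, Sum.elim_inr, Matrix.fromBlocks_apply₂₁, Finset.mem_Icc, h,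
            if_true, Matrix.mul_one, Matrix.mul_zero, add_zero]
          rw [if_neg (by omega)]; rfl
        · simp only [hR, Matrix.of_apply, Sum.elim_inr, Matrix.fromBlocks_apply₂₁, Finset.mem_Icc, h,
            if_false, Matrix.mul_one, Matrix.mul_zero, add_zero]
          rw [if_neg (by omega)]; rfl
      · by_cases h : 1 ≤ (i : ℕ) ∧ (i : ℕ) ≤ l
        · simp only [hR, Matrix.of_apply, Sum.elim_inr, Matrix.fromBlocks_apply₂₂, Finset.mem_Icc, h,
            if_true, Matrix.mul_one, Matrix.mul_neg]
          rw [if_neg (by omega)]; simp [h]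
        · simp only [hR, Matrix.of_apply, Sum.elim_inr, Matrix.fromBlocks_apply₂₂, Finset.mem_Icc, h,
            if_false, Matrix.mul_one, Matrix.mul_neg]
          rw [if_neg (by omega)]; simp [h]
    rw [this, Matrix.det_mul, Matrix.det_fromBlocks_zero₂₁]
    simp
  have hstep : ∀ k, k ≤ l → (R k).det = (R 0).det := by
    intro k
    induction k with
    | zero => intro _; rfl
    | succ k ih =>
      intro hk
      rw [← ih (by omega)]
      refine det_swap_neg _ _ (p := Sum.inl ⟨k, by omega⟩) (q := Sum.inr ⟨k + 1, by omega⟩)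
        (by simp) ?_ ?_ ?_
      · funext c
        simp only [hR, Matrix.of_apply, Sum.elim_inl, Sum.elim_inr]
        rw [if_pos (by omega), if_neg (by omega), if_pos (by omega)]
      · funext c
        simp only [hR, Matrix.of_apply, Sum.elim_inl, Sum.elim_inr, Pi.neg_apply]
        rw [if_pos (by omega), if_neg (by omega), if_pos (by omega)]
        rcases c with c | c <;> simp
      · rintro (r | r) h1 h2
        · have : (r : ℕ) ≠ k := fun h => h1 (congrArg Sum.inl (Fin.ext h))
          funext c
          simp only [hR, Matrix.of_apply, Sum.elim_inl]
          by_cases h : (r : ℕ) < k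
          · rw [if_pos (by omega), if_pos h]
          · rw [if_neg (by omega), if_neg h]
        · have : (r : ℕ) ≠ k + 1 := fun h => h2 (congrArg Sum.inr (Fin.ext h))
          funext c
          simp only [hR, Matrix.of_apply, Sum.elim_inr]
          by_cases h : 1 ≤ (r : ℕ) ∧ (r : ℕ) ≤ k
          · rw [if_pos (by omega), if_pos h]
          · rw [if_neg (by omega), if_neg h]
  rw [h0, ← hstep l le_rfl]
  have : R l = Matrix.fromBlocks
      (Matrix.of fun i : Fin K => (if (i : ℕ) < l then y (i + 1) else x i)) 0
      (Matrix.of fun j : Fin K => (if 1 ≤ (j : ℕ) ∧ (j : ℕ) ≤ l then - x (j - 1) else 0))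
      (Matrix.of fun j : Fin K => (if 1 ≤ (j : ℕ) ∧ (j : ℕ) ≤ l then x (j - 1) else y j)) := by
    ext (i | i) (j | j)
    · by_cases h : (i : ℕ) < l <;> simp [hR, h]
    · by_cases h : (i : ℕ) < l <;> simp [hR, h]
    · by_cases h : 1 ≤ (i : ℕ) ∧ (i : ℕ) ≤ l
      · simp only [hR, Matrix.of_apply, Sum.elim_inr, Matrix.fromBlocks_apply₂₁]
        rw [if_pos h, if_pos h]; rfl
      · simp only [hR, Matrix.of_apply, Sum.elim_inr, Matrix.fromBlocks_apply₂₁]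
        rw [if_neg h, if_neg h, if_neg h]; rfl
    · by_cases h : 1 ≤ (i : ℕ) ∧ (i : ℕ) ≤ l
      · simp only [hR, Matrix.of_apply, Sum.elim_inr, Matrix.fromBlocks_apply₂₂]
        rw [if_pos h, if_pos h]; rfl
      · simp only [hR, Matrix.of_apply, Sum.elim_inr, Matrix.fromBlocks_apply₂₂]
        rw [if_neg h, if_neg h, if_neg h]; rfl
  rw [this, Matrix.det_fromBlocks_zero₁₂]
  rfl

end LinAlg

section Chain

variable {K : ℕ}

/-- the cyclic permutation `a ↦ b`, `i ↦ i - 1` for `a < i ≤ b`. -/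
def cyc (a b : ℕ) (hab : a ≤ b) (hb : b < K) : Equiv.Perm (Fin K) where
  toFun i := if (i : ℕ) = a then ⟨b, hb⟩ else
    if h : a < (i : ℕ) ∧ (i : ℕ) ≤ b then ⟨(i : ℕ) - 1, by omega⟩ else i
  invFun i := if (i : ℕ) = b then ⟨a, by omega⟩ else
    if h : a ≤ (i : ℕ) ∧ (i : ℕ) < b then ⟨(i : ℕ) + 1, by omega⟩ else i
  left_inv i := by
    ext
    by_cases h1 : (i : ℕ) = a
    · simp [h1]
    · by_cases h2 : a < (i : ℕ) ∧ (i : ℕ) ≤ b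
      · have h3 : ¬ ((i : ℕ) - 1 = b) := by omega
        have h4 : a ≤ (i : ℕ) - 1 ∧ (i : ℕ) - 1 < b := by omega
        simp [h1, h2, h3, h4]
        omega
      · have h3 : ¬ ((i : ℕ) = b) := by omega
        have h4 : ¬ (a ≤ (i : ℕ) ∧ (i : ℕ) < b) := by omega
        simp [h1, h2, h3, h4]
  right_inv i := by
    ext
    by_cases h1 : (i : ℕ) = b
    · simp [h1]
    · by_cases h2 : a ≤ (i : ℕ) ∧ (i : ℕ) < b
      · have h3 : ¬ ((i : ℕ) + 1 = a) := by omega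
        have h4 : a < (i : ℕ) + 1 ∧ (i : ℕ) + 1 ≤ b := by omega
        simp [h1, h2, h3, h4]
      · have h3 : ¬ ((i : ℕ) = a) := by omega
        have h4 : ¬ (a < (i : ℕ) ∧ (i : ℕ) ≤ b) := by omega
        simp [h1, h2, h3, h4]

theorem cyc_apply (a b : ℕ) (hab : a ≤ b) (hb : b < K) (i : Fin K) :
    ((cyc a b hab hb i : Fin K) : ℕ) = if (i : ℕ) = a then b else
      if a < (i : ℕ) ∧ (i : ℕ) ≤ b then (i : ℕ) - 1 else i := by
  change ((if (i : ℕ) = a then (⟨b, hb⟩ : Fin K) else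
    if h : a < (i : ℕ) ∧ (i : ℕ) ≤ b then ⟨(i : ℕ) - 1, by omega⟩ else i : Fin K) : ℕ) = _
  split_ifs <;> rfl

theorem cyc_inv_apply (a b : ℕ) (hab : a ≤ b) (hb : b < K) (i : Fin K) :
    (((cyc a b hab hb)⁻¹ i : Fin K) : ℕ) = if (i : ℕ) = b then a else
      if a ≤ (i : ℕ) ∧ (i : ℕ) < b then (i : ℕ) + 1 else i := by
  change ((if (i : ℕ) = b then (⟨a, by omega⟩ : Fin K) else
    if h : a ≤ (i : ℕ) ∧ (i : ℕ) < b then ⟨(i : ℕ) + 1, by omega⟩ else i : Fin K) : ℕ) = _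
  split_ifs <;> rfl

/-- left rows -/
def xr (v : ℤ → Fin K → ℂ) (κ : ℕ → ℕ) : ℕ → Fin K → ℂ := fun i => v ((i : ℤ) - (κ i : ℤ))

/-- right rows -/
def yr (v : ℤ → Fin K → ℂ) (e : Fin K → ℂ) (κ : ℕ → ℕ) : ℕ → Fin K → ℂ :=
  fun j => if j = 0 then e else v ((j : ℤ) - (κ (j - 1) : ℤ))

/-- iterated operators along a list -/
def foldA (l : List (ℕ × ℕ)) (ν : ℕ → ℕ) : ℕ → ℕ := l.foldr (fun p k => AddOp p.1 p.2 k) ν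

/-- iterated operators along a list -/
def foldR (l : List (ℕ × ℕ)) (ν : ℕ → ℕ) : ℕ → ℕ := l.foldr (fun p k => RemOp p.1 p.2 k) ν

theorem AddOp_antitone {a b : ℕ} {k : ℕ → ℕ} (hk : Antitone k) (ha : 1 ≤ a)
    (h1 : k a < k (a - 1)) : Antitone (AddOp a b k) := by
  refine antitone_nat_of_succ_le fun i => ?_
  have e1 : k (i + 1) ≤ k i := hk (by omega)
  have e2 : k i ≤ k (i - 1) := hk (by omega)
  simp only [AddOp, Nat.add_sub_cancel]
  split_ifs with h1 h2 h3 h4 h5 h6 h7 h8 h9 <;> first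
    | omega
    | (have : a = i + 1 := by omega
       subst this; simp only [Nat.add_sub_cancel] at *; omega)
    | (have : a = i := by omega
       subst this; omega)

theorem RemOp_antitone {a b : ℕ} {k : ℕ → ℕ} (hk : Antitone k) (ha : 1 ≤ a) (hab : a ≤ b)
    (h1 : k b < k (b - 1)) : Antitone (RemOp a b k) := by
  refine antitone_nat_of_succ_le fun i => ?_
  have e1 : k (i + 1) ≤ k i := hk (by omega)
  have e2 : k (i + 1 + 1) ≤ k (i + 1) := hk (by omega)
  simp only [RemOp]
  split_ifs with h1 h2 h3 h4 h5 h6 h7 h8 h9 <;> first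
    | omega
    | (have : b = i + 1 := by omega
       subst this; simp only [Nat.add_sub_cancel] at *; omega)
    | (have : b = i + 1 + 1 := by omega
       subst this; simp only [Nat.add_sub_cancel] at *; omega)

def Good (ν : ℕ → ℕ) (K : ℕ) (p : ℕ × ℕ) : Prop :=
  1 ≤ p.1 ∧ p.1 ≤ p.2 ∧ p.2 < K ∧ ν p.1 < ν (p.1 - 1) ∧ ν p.2 < ν (p.2 - 1)

theorem chain_basic {ν : ℕ → ℕ} (hν : Antitone ν) (K : ℕ) : ∀ l : List (ℕ × ℕ),
    l.Pairwise (fun p p' => p.1 < p'.1 ∧ p'.2 < p.2) → (∀ p ∈ l, Good ν K p) →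
    Antitone (foldA l ν) ∧ Antitone (foldR l ν) ∧
    (∀ i, (∀ p ∈ l, i < p.1 ∨ p.2 < i) → foldA l ν i = ν i) ∧
    (∀ i, (∀ p ∈ l, i + 1 < p.1 ∨ p.2 ≤ i) → foldR l ν i = ν i) ∧
    (∀ i, foldR l ν i ≤ ν i) := by
  intro l
  induction l with
  | nil => intro _ _; exact ⟨hν, hν, fun _ _ => rfl, fun _ _ => rfl, fun _ => le_rfl⟩
  | cons p l ih =>
    intro hp hg
    obtain ⟨a, b⟩ := p
    rw [List.pairwise_cons] at hp
    obtain ⟨i1, i2, i3, i4, i5⟩ := ih hp.2 fun p hp => hg p (List.mem_cons_of_mem _ hp)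
    obtain ⟨g1, g2, g3, g4, g5⟩ := hg (a, b) List.mem_cons_self
    simp only at g1 g2 g3 g4 g5
    have hp1 : ∀ p ∈ l, a < p.1 ∧ p.2 < b := fun p h => hp.1 p h
    have eA : foldA ((a, b) :: l) ν = AddOp a b (foldA l ν) := rfl
    have eR : foldR ((a, b) :: l) ν = RemOp a b (foldR l ν) := rfl
    rw [eA, eR]
    refine ⟨?_, ?_, ?_, ?_, ?_⟩
    · refine AddOp_antitone i1 g1 ?_
      rw [i3 a (fun p h => Or.inl (hp1 p h).1), i3 (a - 1) (fun p h => Or.inl (by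
        have := (hp1 p h).1; omega))]
      exact g4
    · refine RemOp_antitone i2 g1 g2 ?_
      rw [i4 b (fun p h => Or.inr (hp1 p h).2.le), i4 (b - 1) (fun p h => Or.inr (by
        have := (hp1 p h).2; omega))]
      exact g5
    · intro i hi
      have h0 := hi (a, b) List.mem_cons_self
      simp only at h0
      have h1 := i3 i fun p hp => hi p (List.mem_cons_of_mem _ hp)
      rw [← h1]
      simp only [AddOp]
      split_ifs <;> first | rfl | omega
    · intro i hi
      have h0 := hi (a, b) List.mem_cons_self
      simp only at h0
      have h1 := i4 i fun p hp => hi p (List.mem_cons_of_mem _ hp)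
      rw [← h1]
      simp only [RemOp]
      split_ifs <;> first | rfl | omega
    · intro i
      have e1 : foldR l ν (i + 1) ≤ foldR l ν i := i2 (by omega)
      have e2 := i5 i
      simp only [RemOp]
      split_ifs with h1 h2 h3 <;> first
        | omega
        | (subst h3; omega)

theorem chain_perm {ν : ℕ → ℕ} (hν : Antitone ν) (v : ℤ → Fin K → ℂ) (e : Fin K → ℂ) :
    ∀ l : List (ℕ × ℕ),
    l.Pairwise (fun p p' => p.1 < p'.1 ∧ p'.2 < p.2) → (∀ p ∈ l, Good ν K p) →
    ∃ π : Equiv.Perm (Fin K ⊕ Fin K), Equiv.Perm.sign π = (-1) ^ l.length ∧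
      (∀ i : Fin K, (∀ p ∈ l, (i : ℕ) < p.1 ∨ p.2 < (i : ℕ)) →
        π (Sum.inl i) = Sum.inl i ∧ π (Sum.inr i) = Sum.inr i) ∧
      ∀ r, blk (xr v (foldA l ν)) (yr v e (foldR l ν)) ∅ ∅ r =
        blk (xr v ν) (yr v e ν) (l.map Prod.snd).toFinset (l.map Prod.fst).toFinset (π r) := by
  intro l
  induction l with
  | nil => intro _ _; exact ⟨1, by simp, by simp, by intro r; rfl⟩
  | cons p l ih =>
    intro hp hg
    obtain ⟨a, b⟩ := p
    rw [List.pairwise_cons] at hp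
    have hg' : ∀ p ∈ l, Good ν K p := fun p hp => hg p (List.mem_cons_of_mem _ hp)
    obtain ⟨π, hs, hfix, hrow⟩ := ih hp.2 hg'
    obtain ⟨i1, i2, i3, i4, i5⟩ := chain_basic hν K l hp.2 hg'
    obtain ⟨g1, g2, g3, g4, g5⟩ := hg (a, b) List.mem_cons_self
    simp only at g1 g2 g3 g4 g5
    have hp1 : ∀ p ∈ l, a < p.1 ∧ p.2 < b := fun p h => hp.1 p h
    have eA : foldA ((a, b) :: l) ν = AddOp a b (foldA l ν) := rfl
    have eR : foldR ((a, b) :: l) ν = RemOp a b (foldR l ν) := rfl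
    rw [eA, eR]
    set P' := (l.map Prod.snd).toFinset with hP'
    set Q' := (l.map Prod.fst).toFinset with hQ'
    have eP : (((a, b) :: l).map Prod.snd).toFinset = insert b P' := by simp [hP']
    have eQ : (((a, b) :: l).map Prod.fst).toFinset = insert a Q' := by simp [hQ']
    rw [eP, eQ]
    set fa : Fin K := ⟨a, by omega⟩ with hfa
    set fb : Fin K := ⟨b, g3⟩ with hfb
    set c := cyc (K := K) a b g2 g3 with hc
    have fixa := (hfix fa fun p h => Or.inl (hp1 p h).1).2
    have fixb := (hfix fb fun p h => Or.inr (hp1 p h).2).1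
    have H1 : ∀ s, s ≠ Sum.inl fb → s ≠ Sum.inr fa →
        blk (xr v ν) (yr v e ν) (insert b P') (insert a Q') (π s) =
        blk (xr v (foldA l ν)) (yr v e (foldR l ν)) ∅ ∅ s := by
      intro s h1 h2
      rw [hrow]
      have n1 : π s ≠ Sum.inl fb := fun h => h1 (π.injective (h.trans fixb.symm))
      have n2 : π s ≠ Sum.inr fa := fun h => h2 (π.injective (h.trans fixa.symm))
      rcases hps : π s with i | i
      · have : (i : ℕ) ≠ b := fun h => n1 (hps.trans (congrArg Sum.inl (Fin.ext h)))
        rw [blk_inl, blk_inl]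
        simp only [Finset.mem_insert, this, false_or]
      · have : (i : ℕ) ≠ a := fun h => n2 (hps.trans (congrArg Sum.inr (Fin.ext h)))
        rw [blk_inr, blk_inr]
        simp only [Finset.mem_insert, this, false_or]
    have H2 : blk (xr v ν) (yr v e ν) (insert b P') (insert a Q') (π (Sum.inl fb)) =
        Sum.elim (0 : Fin K → ℂ) (xr v ν b) := by
      rw [fixb, blk_inl, if_pos (by simp [hfb])]
    have H3 : blk (xr v ν) (yr v e ν) (insert b P') (insert a Q') (π (Sum.inr fa)) =
        Sum.elim (yr v e ν a) (0 : Fin K → ℂ) := by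
      rw [fixa, blk_inr, if_pos (by simp [hfa])]
    have hne : (Sum.inl fb : Fin K ⊕ Fin K) ≠ Sum.inr fa := by simp
    refine ⟨π * (Equiv.swap (Sum.inl fb) (Sum.inr fa) * Equiv.sumCongr c c⁻¹), ?_, ?_, ?_⟩
    · rw [Equiv.Perm.sign_mul, Equiv.Perm.sign_mul, hs, Equiv.Perm.sign_swap hne]
      have : Equiv.Perm.sign (Equiv.sumCongr c c⁻¹ : Equiv.Perm (Fin K ⊕ Fin K)) = 1 := by
        have := Equiv.Perm.sign_sumCongr c c⁻¹
        rw [Equiv.Perm.sign_inv, Int.units_mul_self] at this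
        exact this
      rw [this, List.length_cons, pow_succ, mul_one]
    · intro i hi
      have h0 := hi (a, b) List.mem_cons_self
      simp only at h0
      have h1 := hfix i fun p hp => hi p (List.mem_cons_of_mem _ hp)
      have c1 : c i = i := by
        ext; rw [hc, cyc_apply, if_neg (by omega), if_neg (by omega)]
      have c2 : c⁻¹ i = i := by
        ext; rw [hc, cyc_inv_apply, if_neg (by omega), if_neg (by omega)]
      have n1 : i ≠ fb := fun h => by have := congrArg Fin.val h; simp [hfb] at this; omega
      have n2 : i ≠ fa := fun h => by have := congrArg Fin.val h; simp [hfa] at this; omega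
      constructor
      · rw [Equiv.Perm.mul_apply, Equiv.Perm.mul_apply, Equiv.sumCongr_apply, Sum.map_inl, c1,
          Equiv.swap_apply_of_ne_of_ne (by simpa using n1) (by simp)]
        exact h1.1
      · rw [Equiv.Perm.mul_apply, Equiv.Perm.mul_apply, Equiv.sumCongr_apply, Sum.map_inr, c2,
          Equiv.swap_apply_of_ne_of_ne (by simp) (by simpa using n2)]
        exact h1.2
    · rintro (i | i)
      · rw [Equiv.Perm.mul_apply, Equiv.Perm.mul_apply, Equiv.sumCongr_apply, Sum.map_inl]
        rw [blk_inl, if_neg (by simp)]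
        have cv := cyc_apply a b g2 g3 i
        rw [← hc] at cv
        by_cases hia : (i : ℕ) = a
        · rw [if_pos hia] at cv
          have : c i = fb := Fin.ext cv
          rw [this, Equiv.swap_apply_left, H3]
          congr 1
          simp only [xr, yr, hia]
          rw [if_neg (by omega)]
          have : AddOp a b (foldA l ν) a = ν (a - 1) := by
            unfold AddOp
            rw [if_neg (by omega), if_pos rfl]
            exact i3 _ fun p h => Or.inl (by have := (hp1 p h).1; omega)
          rw [this]
        · rw [if_neg hia] at cv
          have n1 : c i ≠ fb := fun h => by
            have : ((_ : Fin K) : ℕ) = b := congrArg Fin.val h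
            rw [cv] at this
            split_ifs at this <;> omega
          rw [Equiv.swap_apply_of_ne_of_ne (by simpa using n1) (by simp),
            H1 _ (by simpa using n1) (by simp), blk_inl, if_neg (by simp)]
          congr 1
          simp only [xr, cv]
          by_cases h : a < (i : ℕ) ∧ (i : ℕ) ≤ b
          · rw [if_pos h]
            have : AddOp a b (foldA l ν) i = foldA l ν (i - 1) + 1 := by
              simp only [AddOp]
              rw [if_neg (by omega), if_neg (by omega), if_pos (by omega)]
            rw [this]
            congr 1
            push_cast [Nat.cast_sub (show 1 ≤ (i : ℕ) by omega)]
            ring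
          · rw [if_neg h]
            have : AddOp a b (foldA l ν) i = foldA l ν i := by
              simp only [AddOp]
              split_ifs <;> first | rfl | omega
            rw [this]
      · rw [Equiv.Perm.mul_apply, Equiv.Perm.mul_apply, Equiv.sumCongr_apply, Sum.map_inr]
        rw [blk_inr, if_neg (by simp)]
        have cv := cyc_inv_apply a b g2 g3 i
        rw [← hc] at cv
        by_cases hib : (i : ℕ) = b
        · rw [if_pos hib] at cv
          have : c⁻¹ i = fa := Fin.ext cv
          rw [this, Equiv.swap_apply_right, H2]
          congr 1
          simp only [xr, yr, hib]
          rw [if_neg (by omega)]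
          have : RemOp a b (foldR l ν) (b - 1) = ν b := by
            simp only [RemOp]
            rw [if_neg (by omega), if_neg (by omega), if_pos (by omega)]
            exact i4 _ fun p h => Or.inr (by have := (hp1 p h).2; omega)
          rw [this]
        · rw [if_neg hib] at cv
          have n1 : c⁻¹ i ≠ fa := fun h => by
            have : ((_ : Fin K) : ℕ) = a := congrArg Fin.val h
            rw [cv] at this
            split_ifs at this <;> omega
          rw [Equiv.swap_apply_of_ne_of_ne (by simp) (by simpa using n1),
            H1 _ (by simp) (by simpa using n1), blk_inr, if_neg (by simp)]
          congr 1
          simp only [yr, cv]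
          by_cases h : a ≤ (i : ℕ) ∧ (i : ℕ) < b
          · rw [if_pos h, if_neg (by omega), if_neg (by omega)]
            have e1 : RemOp a b (foldR l ν) (i - 1) = foldR l ν i - 1 := by
              simp only [RemOp]
              rw [if_neg (by omega), if_pos (by omega), Nat.sub_add_cancel (by omega)]
            have e2 : foldR l ν (b - 1) ≤ foldR l ν i := i2 (by omega)
            rw [i4 (b - 1) fun p h => Or.inr (by have := (hp1 p h).2; omega)] at e2
            rw [e1, Nat.add_sub_cancel]
            congr 1
            push_cast [Nat.cast_sub (show 1 ≤ foldR l ν i by omega)]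
            ring
          · rw [if_neg h]
            by_cases h0 : (i : ℕ) = 0
            · rw [if_pos h0, if_pos h0]
            · rw [if_neg h0, if_neg h0]
              have : RemOp a b (foldR l ν) (i - 1) = foldR l ν (i - 1) := by
                simp only [RemOp]
                split_ifs <;> first | rfl | omega
              rw [this]

theorem chain_det {ν : ℕ → ℕ} (hν : Antitone ν) (v : ℤ → Fin K → ℂ) (e : Fin K → ℂ)
    (l : List (ℕ × ℕ))
    (hl : l.Pairwise (fun p p' => p.1 < p'.1 ∧ p'.2 < p.2)) (hg : ∀ p ∈ l, Good ν K p) :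
    dt (xr v (foldA l ν)) * dt (yr v e (foldR l ν)) = (-1) ^ l.length *
      (blk (xr v ν) (yr v e ν) (l.map Prod.snd).toFinset (l.map Prod.fst).toFinset).det := by
  obtain ⟨π, hs, -, hrow⟩ := chain_perm hν v e l hl hg
  rw [← blk_empty]
  have : blk (xr v (foldA l ν)) (yr v e (foldR l ν)) ∅ ∅ =
      (blk (xr v ν) (yr v e ν) (l.map Prod.snd).toFinset (l.map Prod.fst).toFinset).submatrix
        π id := by
    ext r c
    exact congrFun (hrow r) c
  rw [this, Matrix.det_permute, hs]
  push_cast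
  rfl

end Chain

section Step

variable {n : ℕ} {m rr : ℕ → ℕ}

theorem stepPart_eq {i j : ℕ} (hj : j < n) (h1 : i < rr j) (h2 : ∀ j' < j, rr j' ≤ i) :
    stepPart n m rr i = m j := by
  have hmem : j ∈ (Finset.range n).filter fun j => i < rr j := by simp [hj, h1]
  have hne : ((Finset.range n).filter fun j => i < rr j).Nonempty := ⟨j, hmem⟩
  unfold stepPart
  rw [dif_pos hne]
  congr 1
  refine le_antisymm (Finset.min'_le _ _ hmem) ?_
  have := Finset.min'_mem _ hne
  simp only [Finset.mem_filter, Finset.mem_range] at this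
  by_contra hlt
  have := h2 _ (not_le.1 hlt)
  omega

theorem stepPart_zero {i : ℕ} (h : ∀ j < n, rr j ≤ i) : stepPart n m rr i = 0 := by
  unfold stepPart
  rw [dif_neg]
  rintro ⟨j, hj⟩
  simp only [Finset.mem_filter, Finset.mem_range] at hj
  have := h j hj.1
  omega

theorem step_cases (n : ℕ) (rr : ℕ → ℕ) (i : ℕ) :
    (∀ j < n, rr j ≤ i) ∨ ∃ j < n, i < rr j ∧ ∀ j' < j, rr j' ≤ i := by
  classical
  by_cases h : ∃ j, j < n ∧ i < rr j
  · right
    refine ⟨Nat.find h, (Nat.find_spec h).1, (Nat.find_spec h).2, fun j' hj' => ?_⟩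
    have := Nat.find_min h hj'
    have h2 := (Nat.find_spec h).1
    by_contra hc
    exact this ⟨by omega, by omega⟩
  · left
    intro j hj
    by_contra hc
    exact h ⟨j, hj, by omega⟩

theorem strict_of_succ {f : ℕ → ℕ} (hf : ∀ j, j + 1 < n → f j < f (j + 1)) :
    ∀ i j, i < j → j < n → f i < f j := by
  intro i j hij
  induction j, hij using Nat.le_induction with
  | base => intro h; exact hf i h
  | succ k hk ih => intro h; exact (ih (by omega)).trans (hf k h)

theorem strictAnti_of_succ {f : ℕ → ℕ} (hf : ∀ j, j + 1 < n → f (j + 1) < f j) :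
    ∀ i j, i < j → j < n → f j < f i := by
  intro i j hij
  induction j, hij using Nat.le_induction with
  | base => intro h; exact hf i h
  | succ k hk ih => intro h; exact (hf k h).trans (ih (by omega))

theorem stepPart_antitone (hm : ∀ j, j + 1 < n → m (j + 1) < m j) :
    Antitone (stepPart n m rr) := by
  intro i i' hii
  rcases step_cases n rr i' with h | ⟨j', hj', h1, h2⟩
  · rw [stepPart_zero h]; exact Nat.zero_le _
  · rw [stepPart_eq hj' h1 h2]
    rcases step_cases n rr i with h | ⟨j, hj, g1, g2⟩
    · have := h j' hj'; omega
    · rw [stepPart_eq hj g1 g2]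
      rcases lt_trichotomy j j' with h | h | h
      · exact (strictAnti_of_succ hm _ _ h hj').le
      · rw [h]
      · have := g2 _ h; omega

theorem stepPart_le (hm : ∀ j, j + 1 < n → m (j + 1) < m j) (i : ℕ) :
    stepPart n m rr i ≤ m 0 := by
  rcases step_cases n rr i with h | ⟨j, hj, g1, g2⟩
  · rw [stepPart_zero h]; exact Nat.zero_le _
  · rw [stepPart_eq hj g1 g2]
    rcases Nat.eq_zero_or_pos j with h | h
    · rw [h]
    · exact (strictAnti_of_succ hm _ _ h hj).le

theorem stepPart_corner (hm : ∀ j, j + 1 < n → m (j + 1) < m j) (hmpos : 0 < m (n - 1))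
    (hrr : ∀ j, j + 1 < n → rr j < rr (j + 1)) (hrrpos : 0 < rr 0) {j : ℕ} (hj : j < n) :
    1 ≤ rr j ∧ stepPart n m rr (rr j) < stepPart n m rr (rr j - 1) := by
  have hs := strict_of_succ hrr
  have hpos : 1 ≤ rr j := by
    rcases Nat.eq_zero_or_pos j with h | h
    · rw [h]; exact hrrpos
    · have := hs _ _ h hj; omega
  refine ⟨hpos, ?_⟩
  have hlow : ∀ j' < j, rr j' ≤ rr j - 1 := fun j' h => by have := hs _ _ h hj; omega
  rw [stepPart_eq (m := m) (i := rr j - 1) hj (by omega) hlow]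
  by_cases h : j + 1 < n
  · rw [stepPart_eq (m := m) h (hrr j h) (fun j' h' => ?_)]
    · exact hm j h
    · rcases Nat.lt_succ_iff_lt_or_eq.1 h' with h'' | h''
      · exact (hs _ _ h'' hj).le
      · rw [h'']
  · have e : j = n - 1 := by omega
    rw [stepPart_zero (fun j' h' => ?_)]
    · rw [e]; exact hmpos
    · rcases lt_or_eq_of_le (show j' ≤ j by omega) with h'' | h''
      · exact (hs _ _ h'' hj).le
      · rw [h'']

theorem stepPart_noncorner {i : ℕ} (hi : 1 ≤ i) (h : ∀ j < n, rr j ≠ i) :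
    stepPart n m rr (i - 1) = stepPart n m rr i := by
  rcases step_cases n rr i with h0 | ⟨j, hj, g1, g2⟩
  · rw [stepPart_zero h0, stepPart_zero fun j hj => by
      have := h j hj; have := h0 j hj; omega]
  · rw [stepPart_eq hj g1 g2, stepPart_eq hj (by omega) fun j' hj' => by
      have := h j' (by omega); have := g2 j' hj'; omega]

end Step

section Bridge

theorem JT_shift (w : ℕ → ℤ → ℂ) (κ : ℕ → ℕ) (N M : ℕ) :
    JT (fun k c => w k (c + 1)) κ N M =
      dt (yr (K := N + 1) (fun p c => V w M p ((c : ℕ) : ℤ)) (fun c => if c = 0 then 1 else 0) κ) := by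
  unfold dt JT
  rw [Matrix.det_succ_row_zero, Finset.sum_eq_single (0 : Fin (N + 1))]
  · have e0 : (Matrix.of fun i : Fin (N + 1) => yr (K := N + 1)
        (fun p c => V w M p ((c : ℕ) : ℤ)) (fun c => if c = 0 then 1 else 0) κ i) 0 0 = 1 := by
      simp [yr]
    rw [e0, Fin.val_zero, pow_zero, one_mul, one_mul]
    refine congrArg (Matrix.det (R := ℂ)) ?_
    ext j i
    simp only [Matrix.of_apply, Matrix.submatrix_apply, Fin.succAbove_zero, Fin.val_succ, yr]
    rw [if_neg (by omega), V_shift, Nat.add_sub_cancel]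
    push_cast
    congr 1
    ring
  · intro j _ hj
    simp [yr, hj]
  · simp

theorem JT_left (w : ℕ → ℤ → ℂ) {κ : ℕ → ℕ} (hκ : Antitone κ) {N : ℕ}
    (hN : ∀ j, N ≤ j → κ j = 0) (M : ℕ) :
    JT w κ N M = dt (xr (K := N + 1) (fun p c => V w M p ((c : ℕ) : ℤ)) κ) := by
  rw [JT_stable hκ hN]
  rfl

variable {K : ℕ}

theorem blk_vanish {ν : ℕ → ℕ} (v : ℤ → Fin K → ℂ) (e : Fin K → ℂ) {P Q : Finset ℕ} {j : ℕ}
    (hj : 1 ≤ j) (hK : j < K) (h : ν (j - 1) = ν j) (hPQ : j ∈ P ↔ j ∉ Q) :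
    (blk (xr v ν) (yr v e ν) P Q).det = 0 := by
  refine Matrix.det_zero_of_row_eq (i := Sum.inl ⟨j, hK⟩) (j := Sum.inr ⟨j, hK⟩) (by simp) ?_
  rw [blk_inl, blk_inr]
  have hxy : xr v ν j = yr v e ν j := by
    simp only [xr, yr]
    rw [if_neg (by omega), h]
  simp only
  rw [hxy]
  by_cases hp : j ∈ P
  · rw [if_pos hp, if_neg (hPQ.1 hp)]
  · rw [if_neg hp, if_pos (by tauto)]

end Bridge

section Comb

theorem sum_powerset_reindex {A B : Finset ℕ} {ρ : ℕ → ℕ} (g : Finset ℕ → ℂ)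
    (hinj : Set.InjOn ρ B) (hBA : B.image ρ ⊆ A)
    (h0 : ∀ P, P ⊆ A → ¬ P ⊆ B.image ρ → g P = 0) :
    ∑ P ∈ A.powerset, g P = ∑ S ∈ B.powerset, g (S.image ρ) := by
  rw [← Finset.sum_subset (Finset.powerset_mono.2 hBA)
    (fun P hP hP' => h0 P (Finset.mem_powerset.1 hP) (fun h => hP' (Finset.mem_powerset.2 h)))]
  symm
  refine Finset.sum_bij (fun S _ => S.image ρ) ?_ ?_ ?_ ?_
  · intro S hS
    rw [Finset.mem_powerset] at hS ⊢
    exact Finset.image_subset_image hS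
  · intro S hS S' hS' h
    rw [Finset.mem_powerset] at hS hS'
    ext i
    constructor
    · intro hi
      have : ρ i ∈ S'.image ρ := by rw [← h]; exact Finset.mem_image_of_mem _ hi
      obtain ⟨i', hi', e⟩ := Finset.mem_image.1 this
      rwa [← hinj (hS' hi') (hS hi) e]
    · intro hi
      have : ρ i ∈ S.image ρ := by rw [h]; exact Finset.mem_image_of_mem _ hi
      obtain ⟨i', hi', e⟩ := Finset.mem_image.1 this
      rwa [← hinj (hS hi') (hS' hi) e]
  · intro P hP
    rw [Finset.mem_powerset, Finset.subset_image_iff] at hP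
    obtain ⟨S, hS, e⟩ := hP
    exact ⟨S, Finset.mem_powerset.2 (by exact_mod_cast hS), e⟩
  · intros; rfl

theorem sum_by_card (A B : Finset ℕ) (h : Finset ℕ → Finset ℕ → ℂ)
    (h0 : ∀ P ⊆ A, ∀ Q ⊆ B, P.card ≠ Q.card → h P Q = 0) :
    ∑ P ∈ A.powerset, ∑ Q ∈ B.powerset, h P Q = h ∅ ∅ +
      ∑ t ∈ Finset.Icc 1 (min A.card B.card), ∑ P ∈ Finset.powersetCard t A,
        ∑ Q ∈ Finset.powersetCard t B, h P Q := by
  rw [Finset.sum_powerset]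
  have e1 : ∀ j, ∑ P ∈ Finset.powersetCard j A, ∑ Q ∈ B.powerset, h P Q =
      ∑ P ∈ Finset.powersetCard j A, ∑ Q ∈ Finset.powersetCard j B, h P Q := by
    intro j
    refine Finset.sum_congr rfl fun P hP => ?_
    rw [Finset.mem_powersetCard] at hP
    symm
    refine Finset.sum_subset ?_ ?_
    · intro Q hQ
      exact Finset.mem_powerset.2 (Finset.mem_powersetCard.1 hQ).1
    · intro Q hQ hQ'
      rw [Finset.mem_powerset] at hQ
      refine h0 P hP.1 Q hQ fun hc => hQ' (Finset.mem_powersetCard.2 ⟨hQ, by omega⟩)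
  rw [Finset.sum_congr rfl fun j _ => e1 j, Finset.sum_range_succ', add_comm]
  congr 1
  · simp
  · rw [Finset.range_eq_Ico, Finset.sum_Ico_add'
      (fun j => ∑ P ∈ Finset.powersetCard j A, ∑ Q ∈ Finset.powersetCard j B, h P Q) 0 A.card 1]
    symm
    refine Finset.sum_subset ?_ ?_
    · intro t ht
      simp only [Finset.mem_Icc, Finset.mem_Ico] at ht ⊢
      omega
    · intro t ht ht'
      simp only [Finset.mem_Icc, Finset.mem_Ico] at ht ht'
      refine Finset.sum_eq_zero fun P _ => ?_
      rw [Finset.powersetCard_eq_empty.2 (by omega), Finset.sum_empty]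

end Comb

section Final

theorem asc_mem {s : Finset ℕ} {i : ℕ} (h : i < s.card) : ascNth s i ∈ s := by
  have hl : i < (s.sort (· ≤ ·)).length := by rw [Finset.length_sort]; exact h
  unfold ascNth
  rw [List.getD_eq_getElem _ _ hl, ← Finset.mem_sort (· ≤ ·)]
  exact List.getElem_mem hl

theorem asc_lt {s : Finset ℕ} {i j : ℕ} (hij : i < j) (h : j < s.card) :
    ascNth s i < ascNth s j := by
  have hl : j < (s.sort (· ≤ ·)).length := by rw [Finset.length_sort]; exact h
  unfold ascNth
  rw [List.getD_eq_getElem _ _ hl, List.getD_eq_getElem _ _ (hij.trans hl)]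
  exact (Finset.sortedLT_sort s).getElem_lt_getElem_of_lt hij

theorem asc_image (s : Finset ℕ) : (Finset.range s.card).image (ascNth s) = s := by
  refine Finset.eq_of_subset_of_card_le ?_ ?_
  · intro j hj
    obtain ⟨i, hi, rfl⟩ := Finset.mem_image.1 hj
    exact asc_mem (Finset.mem_range.1 hi)
  · rw [Finset.card_image_of_injOn, Finset.card_range]
    intro i hi j hj hij
    have hi := Finset.mem_range.1 hi
    have hj := Finset.mem_range.1 hj
    rcases lt_trichotomy i j with h | h | h
    · exact absurd hij (asc_lt h hj).ne
    · exact h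
    · exact absurd hij (asc_lt h hi).ne'

variable {n : ℕ} {m rr : ℕ → ℕ}

theorem pair_list (hm : ∀ j, j + 1 < n → m (j + 1) < m j) (hmpos : 0 < m (n - 1))
    (hrr : ∀ j, j + 1 < n → rr j < rr (j + 1)) (hrrpos : 0 < rr 0)
    {d : ℕ} (hdn : d ≤ n) {K : ℕ} (hK : rr (n - 1) < K) {t : ℕ} {P Q : Finset ℕ}
    (hP : P ∈ Finset.powersetCard t (Finset.Icc 1 d))
    (hQ : Q ∈ Finset.powersetCard t (Finset.Icc d n)) :
    ∃ l : List (ℕ × ℕ), l.length = t ∧ l.Pairwise (fun p p' => p.1 < p'.1 ∧ p'.2 < p.2) ∧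
      (∀ p ∈ l, Good (stepPart n m rr) K p) ∧ (∀ p ∈ l, p.2 ≤ rr (n - 1)) ∧
      foldA l (stepPart n m rr) = iterOp AddOp t (fun i => rr (ascNth P i - 1))
                      (fun i => rr (ascNth Q (t - 1 - i) - 1)) (stepPart n m rr) ∧
      foldR l (stepPart n m rr) = iterOp RemOp t (fun i => rr (ascNth P i - 1))
                      (fun i => rr (ascNth Q (t - 1 - i) - 1)) (stepPart n m rr) ∧
      (l.map Prod.snd).toFinset = Q.image (fun i => rr (i - 1)) ∧
      (l.map Prod.fst).toFinset = P.image (fun i => rr (i - 1)) := by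
  obtain ⟨hPs, hPc⟩ := Finset.mem_powersetCard.1 hP
  obtain ⟨hQs, hQc⟩ := Finset.mem_powersetCard.1 hQ
  have hs := strict_of_succ hrr
  have hle : ∀ i j, i ≤ j → j < n → rr i ≤ rr j := fun i j h hj => by
    rcases lt_or_eq_of_le h with h | h
    · exact (hs _ _ h hj).le
    · rw [h]
  have hPm : ∀ i, i < t → 1 ≤ ascNth P i ∧ ascNth P i ≤ d := fun i hi =>
    Finset.mem_Icc.1 (hPs (asc_mem (by omega)))
  have hQm : ∀ i, i < t → d ≤ ascNth Q i ∧ ascNth Q i ≤ n := fun i hi =>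
    Finset.mem_Icc.1 (hQs (asc_mem (by omega)))
  refine ⟨(List.range t).map fun i => (rr (ascNth P i - 1), rr (ascNth Q (t - 1 - i) - 1)),
    by simp, ?_, ?_, ?_, ?_, ?_, ?_, ?_⟩
  · rw [List.pairwise_map]
    refine List.Pairwise.imp_of_mem ?_ List.pairwise_lt_range
    intro i j hi hj hij
    rw [List.mem_range] at hi hj
    have b1 := hPm i hi
    have b2 := hPm j hj
    have b3 := hQm (t - 1 - i) (by omega)
    have b4 := hQm (t - 1 - j) (by omega)
    have c1 := asc_lt (s := P) hij (by omega)
    have c2 := asc_lt (s := Q) (show t - 1 - j < t - 1 - i by omega) (by omega)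
    exact ⟨hs _ _ (by omega) (by omega), hs _ _ (by omega) (by omega)⟩
  · intro p hp
    obtain ⟨i, hi, rfl⟩ := List.mem_map.1 hp
    rw [List.mem_range] at hi
    have b1 := hPm i hi
    have b3 := hQm (t - 1 - i) (by omega)
    have k1 := stepPart_corner hm hmpos hrr hrrpos (show ascNth P i - 1 < n by omega)
    have k2 := stepPart_corner hm hmpos hrr hrrpos (show ascNth Q (t - 1 - i) - 1 < n by omega)
    refine ⟨k1.1, hle _ _ (by omega) (by omega), ?_, k1.2, k2.2⟩
    exact lt_of_le_of_lt (hle _ _ (by omega) (by omega)) hK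
  · intro p hp
    obtain ⟨i, hi, rfl⟩ := List.mem_map.1 hp
    rw [List.mem_range] at hi
    have b1 := hPm i hi
    have b3 := hQm (t - 1 - i) (by omega)
    exact hle _ _ (by omega) (by omega)
  · simp only [foldA, iterOp, List.foldr_map]
  · simp only [foldR, iterOp, List.foldr_map]
  · ext j
    simp only [List.mem_toFinset, List.mem_map, List.mem_range, Finset.mem_image]
    constructor
    · rintro ⟨p, ⟨i, hi, rfl⟩, rfl⟩
      exact ⟨_, asc_mem (by omega), rfl⟩
    · rintro ⟨q, hq, rfl⟩
      rw [← asc_image Q, Finset.mem_image] at hq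
      obtain ⟨i, hi, rfl⟩ := hq
      rw [Finset.mem_range] at hi
      refine ⟨_, ⟨t - 1 - i, by omega, rfl⟩, ?_⟩
      simp only
      rw [show t - 1 - (t - 1 - i) = i by omega]
  · ext j
    simp only [List.mem_toFinset, List.mem_map, List.mem_range, Finset.mem_image]
    constructor
    · rintro ⟨p, ⟨i, hi, rfl⟩, rfl⟩
      exact ⟨_, asc_mem (by omega), rfl⟩
    · rintro ⟨q, hq, rfl⟩
      rw [← asc_image P, Finset.mem_image] at hq
      obtain ⟨i, hi, rfl⟩ := hq
      rw [Finset.mem_range] at hi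
      exact ⟨_, ⟨i, by omega, rfl⟩, rfl⟩

theorem core {K : ℕ} (hn : 1 ≤ n) (hm : ∀ j, j + 1 < n → m (j + 1) < m j) (hmpos : 0 < m (n - 1))
    (hrr : ∀ j, j + 1 < n → rr j < rr (j + 1)) (hrrpos : 0 < rr 0)
    {d : ℕ} (hd1 : 1 ≤ d) (hdn : d ≤ n) (hK : rr (n - 1) < K)
    (v : ℤ → Fin K → ℂ) (e : Fin K → ℂ) :
    dt (xr v (stepPart n m rr)) * dt (yr v e (stepPart n m rr)) =
      dt (xr v (fun i => if i < rr (d - 1) then stepPart n m rr i - 1 else stepPart n m rr i)) *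
      dt (yr v e (fun i => if i < rr (d - 1) then stepPart n m rr i + 1 else stepPart n m rr i)) +
      ∑ t ∈ Finset.Icc 1 (min d (n - d + 1)),
        (-1 : ℂ) ^ (t - 1) *
          ∑ P ∈ Finset.powersetCard t (Finset.Icc 1 d),
            ∑ Q ∈ Finset.powersetCard t (Finset.Icc d n),
              dt (xr v (iterOp AddOp t (fun i => rr (ascNth P i - 1))
                      (fun i => rr (ascNth Q (t - 1 - i) - 1)) (stepPart n m rr))) *
              dt (yr v e (iterOp RemOp t (fun i => rr (ascNth P i - 1))
                      (fun i => rr (ascNth Q (t - 1 - i) - 1)) (stepPart n m rr))) := by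
  have hν : Antitone (stepPart n m rr) := stepPart_antitone hm
  have hcor := fun j (hj : j < n) => stepPart_corner hm hmpos hrr hrrpos hj
  have hnon := fun i (hi : 1 ≤ i) (h : ∀ j < n, rr j ≠ i) => stepPart_noncorner (m := m) hi h
  have hpl := fun t P Q => @pair_list n m rr hm hmpos hrr hrrpos d hdn K hK t P Q
  generalize stepPart n m rr = ν at *
  have hs := strict_of_succ hrr
  have hle : ∀ i j, i ≤ j → j < n → rr i ≤ rr j := fun i j h hj => by
    rcases lt_or_eq_of_le h with h | h
    · exact (hs _ _ h hj).le
    · rw [h]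
  have hinj : ∀ i j, i < n → j < n → rr i = rr j → i = j := fun i j hi hj h => by
    rcases lt_trichotomy i j with h' | h' | h'
    · have := hs _ _ h' hj; omega
    · exact h'
    · have := hs _ _ h' hi; omega
  set ρ : ℕ → ℕ := fun i => rr (i - 1) with hρ
  have hlK : rr (d - 1) < K := lt_of_le_of_lt (hle _ _ (by omega) (by omega)) hK
  -- the doubled determinant
  have E := dbl_det (xr v ν) (yr v e ν) (rr (d - 1)) hlK
  have ex : (fun i => if i < rr (d - 1) then yr v e ν (i + 1) else xr v ν i) =
      xr v (fun i => if i < rr (d - 1) then ν i - 1 else ν i) := by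
    funext i
    simp only [xr, yr]
    by_cases h1 : i < rr (d - 1)
    · rw [if_pos h1, if_neg (by omega), if_pos h1]
      have h3 := (hcor (d - 1) (by omega)).2
      have h4 : ν (rr (d - 1) - 1) ≤ ν i := hν (by omega)
      congr 1
      rw [Nat.add_sub_cancel]
      push_cast [Nat.cast_sub (show 1 ≤ ν i by omega)]
      ring
    · rw [if_neg h1, if_neg h1]
  have ey : (fun j => if 1 ≤ j ∧ j ≤ rr (d - 1) then xr v ν (j - 1) else yr v e ν j) =
      yr v e (fun i => if i < rr (d - 1) then ν i + 1 else ν i) := by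
    funext j
    simp only [xr, yr]
    by_cases h0 : j = 0
    · rw [if_neg (by omega), if_pos h0, if_pos h0]
    · rw [if_neg h0]
      by_cases h1 : j ≤ rr (d - 1)
      · rw [if_pos (by omega), if_neg h0, if_pos (by omega)]
        congr 1
        push_cast [Nat.cast_sub (show 1 ≤ j by omega)]
        ring
      · rw [if_neg (by omega), if_neg h0, if_neg (by omega)]
  rw [ex, ey] at E
  rw [← E, dbl_expand _ _ (by intro i hi; simp at hi ⊢; omega) (by intro i hi; simp at hi ⊢; omega)]
  -- restrict to corners
  have injA : Set.InjOn ρ (Finset.Icc 1 d : Finset ℕ) := by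
    intro i hi j hj h
    simp only [Finset.coe_Icc, Set.mem_Icc] at hi hj
    have := hinj (i - 1) (j - 1) (by omega) (by omega) h
    omega
  have injB : Set.InjOn ρ (Finset.Icc d n : Finset ℕ) := by
    intro i hi j hj h
    simp only [Finset.coe_Icc, Set.mem_Icc] at hi hj
    have := hinj (i - 1) (j - 1) (by omega) (by omega) h
    omega
  have subA : (Finset.Icc 1 d).image ρ ⊆ Finset.Icc 1 (rr (d - 1)) := by
    intro j hj
    obtain ⟨i, hi, rfl⟩ := Finset.mem_image.1 hj
    rw [Finset.mem_Icc] at hi ⊢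
    exact ⟨(hcor (i - 1) (by omega)).1, hle _ _ (by omega) (by omega)⟩
  have subB : (Finset.Icc d n).image ρ ⊆ Finset.Ico (rr (d - 1)) K := by
    intro j hj
    obtain ⟨i, hi, rfl⟩ := Finset.mem_image.1 hj
    rw [Finset.mem_Icc] at hi
    rw [Finset.mem_Ico]
    exact ⟨hle _ _ (by omega) (by omega), lt_of_le_of_lt (hle _ _ (by omega) (by omega)) hK⟩
  have vB : ∀ P, P ⊆ Finset.Ico (rr (d - 1)) K → ¬ P ⊆ (Finset.Icc d n).image ρ →
      ∀ Q ⊆ Finset.Icc 1 (rr (d - 1)), (blk (xr v ν) (yr v e ν) P Q).det = 0 := by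
    intro P hP hn' Q hQ
    obtain ⟨j, hj, hj'⟩ := Finset.not_subset.1 hn'
    have h1 := Finset.mem_Ico.1 (hP hj)
    have hc1 := (hcor (d - 1) (by omega)).1
    have h2 : ∀ i < n, rr i ≠ j := by
      intro i hi hij
      by_cases hid : d - 1 ≤ i
      · exact hj' (Finset.mem_image.2 ⟨i + 1, Finset.mem_Icc.2 ⟨by omega, by omega⟩, by
          simpa [hρ] using hij⟩)
      · have := hs i (d - 1) (by omega) (by omega)
        omega
    have h3 : j ∉ Q := fun h => by
      have := Finset.mem_Icc.1 (hQ h)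
      have := h2 (d - 1) (by omega)
      omega
    exact blk_vanish v e (by omega) h1.2 (hnon j (by omega) h2) (by tauto)
  have vA : ∀ P, P ⊆ Finset.Ico (rr (d - 1)) K → 
      ∀ Q ⊆ Finset.Icc 1 (rr (d - 1)), ¬ Q ⊆ (Finset.Icc 1 d).image ρ →
      (blk (xr v ν) (yr v e ν) P Q).det = 0 := by
    intro P hP Q hQ hn'
    obtain ⟨j, hj, hj'⟩ := Finset.not_subset.1 hn'
    have h1 := Finset.mem_Icc.1 (hQ hj)
    have h2 : ∀ i < n, rr i ≠ j := by
      intro i hi hij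
      by_cases hid : i ≤ d - 1
      · exact hj' (Finset.mem_image.2 ⟨i + 1, Finset.mem_Icc.2 ⟨by omega, by omega⟩, by
          simpa [hρ] using hij⟩)
      · have := hs (d - 1) i (by omega) (by omega)
        omega
    have h3 : j ∉ P := fun h => by
      have := Finset.mem_Ico.1 (hP h)
      have := h2 (d - 1) (by omega)
      omega
    exact blk_vanish v e (by omega) (by omega) (hnon j (by omega) h2) (by tauto)
  rw [sum_powerset_reindex (B := Finset.Icc d n) (ρ := ρ) _ injB subB
    (fun P hP hP' => Finset.sum_eq_zero fun Q hQ => vB P hP hP' Q (Finset.mem_powerset.1 hQ))]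
  have e2 : ∑ S ∈ (Finset.Icc d n).powerset, ∑ Q ∈ (Finset.Icc 1 (rr (d - 1))).powerset,
        (blk (xr v ν) (yr v e ν) (S.image ρ) Q).det =
      ∑ S ∈ (Finset.Icc d n).powerset, ∑ T ∈ (Finset.Icc 1 d).powerset,
        (blk (xr v ν) (yr v e ν) (S.image ρ) (T.image ρ)).det := by
    refine Finset.sum_congr rfl fun S hS => ?_
    have hS' := (Finset.image_subset_image (f := ρ) (Finset.mem_powerset.1 hS)).trans subB
    exact sum_powerset_reindex _ injA subA fun Q hQ hQ' => vA _ hS' Q hQ hQ'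
  rw [e2, Finset.sum_comm, sum_by_card (Finset.Icc 1 d) (Finset.Icc d n)
    (fun T S => (blk (xr v ν) (yr v e ν) (S.image ρ) (T.image ρ)).det)]
  · simp only [Finset.image_empty, Nat.card_Icc, Nat.add_sub_cancel]
    rw [blk_empty, show n + 1 - d = n - d + 1 by omega, add_assoc, ← Finset.sum_add_distrib]
    symm
    rw [add_eq_left]
    refine Finset.sum_eq_zero fun t ht => ?_
    rw [Finset.mem_Icc] at ht
    rw [Finset.mul_sum, ← Finset.sum_add_distrib]
    refine Finset.sum_eq_zero fun P hP => ?_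
    rw [Finset.mul_sum, ← Finset.sum_add_distrib]
    refine Finset.sum_eq_zero fun Q hQ => ?_
    obtain ⟨l, l1, l2, l3, -, l4, l5, l6, l7⟩ := hpl t P Q hP hQ
    rw [← l4, ← l5, chain_det hν v e l l2 l3, l6, l7, l1]
    obtain ⟨s, rfl⟩ : ∃ s, t = s + 1 := ⟨t - 1, by omega⟩
    rw [Nat.add_sub_cancel, ← mul_assoc, ← pow_add, show s + (s + 1) = 2 * s + 1 by ring, pow_succ,
      pow_mul]
    simp
  · intro T hT S hS hc
    have hT' := (Finset.image_subset_image (f := ρ) hT).trans subA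
    have hS' := (Finset.image_subset_image (f := ρ) hS).trans subB
    refine blk_card_ne _ _ (hS'.trans (by intro i hi; simp at hi ⊢; omega))
      (hT'.trans (by intro i hi; simp at hi ⊢; omega)) ?_
    rw [Finset.card_image_of_injOn (injB.mono (by exact_mod_cast hS)),
      Finset.card_image_of_injOn (injA.mono (by exact_mod_cast hT))]
    exact fun h => hc h.symm

end Final

end PluckerAux

/-- Plücker-type relation for truncated Schur multiple zeta values, dual version
(Corollary 5.4(2)). Here `stepPart n m rr` is the conjugate `λ'` of `λ`. -/
theorem plucker_truncated_schur_zeta_dual (M : ℕ) (hM : 0 < M) (a : ℤ → ℂ)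
    (n : ℕ) (hn : 1 ≤ n) (m rr : ℕ → ℕ)
    (hm : ∀ j, j + 1 < n → m (j + 1) < m j) (hmpos : 0 < m (n - 1))
    (hrr : ∀ j, j + 1 < n → rr j < rr (j + 1)) (hrrpos : 0 < rr 0)
    (d : ℕ) (hd1 : 1 ≤ d) (hdn : d ≤ n) :
    zetaT M (m 0 + 2) (conjF (stepPart n m rr) (rr (n - 1) + n)) (fun _ => 0) a *
        zetaT M (m 0 + 2) (conjF (stepPart n m rr) (rr (n - 1) + n)) (fun _ => 0)
          (fun c => a (c + 1)) =
      zetaT M (m 0 + 2)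
          (conjF
            (fun i => if i < rr (d - 1) then stepPart n m rr i - 1 else stepPart n m rr i)
            (rr (n - 1) + n))
          (fun _ => 0) a *
        zetaT M (m 0 + 2)
          (conjF
            (fun i => if i < rr (d - 1) then stepPart n m rr i + 1 else stepPart n m rr i)
            (rr (n - 1) + n))
          (fun _ => 0) (fun c => a (c + 1)) +
      ∑ t ∈ Finset.Icc 1 (min d (n - d + 1)),
        (-1 : ℂ) ^ (t - 1) *
          ∑ P ∈ Finset.powersetCard t (Finset.Icc 1 d),
            ∑ Q ∈ Finset.powersetCard t (Finset.Icc d n),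
              zetaT M (m 0 + 2)
                  (conjF
                    (iterOp AddOp t (fun i => rr (ascNth P i - 1))
                      (fun i => rr (ascNth Q (t - 1 - i) - 1)) (stepPart n m rr))
                    (rr (n - 1) + n))
                  (fun _ => 0) a *
                zetaT M (m 0 + 2)
                  (conjF
                    (iterOp RemOp t (fun i => rr (ascNth P i - 1))
                      (fun i => rr (ascNth Q (t - 1 - i) - 1)) (stepPart n m rr))
                    (rr (n - 1) + n))
                  (fun _ => 0) (fun c => a (c + 1)) := by
  have hν : Antitone (stepPart n m rr) := PluckerAux.stepPart_antitone hm
  have hν0 : ∀ i, stepPart n m rr i ≤ m 0 := PluckerAux.stepPart_le hm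
  have hle : ∀ i j, i ≤ j → j < n → rr i ≤ rr j := fun i j h hj => by
    rcases lt_or_eq_of_le h with h | h
    · exact (PluckerAux.strict_of_succ hrr _ _ h hj).le
    · rw [h]
  have hνN : ∀ j, rr (n - 1) + n ≤ j → stepPart n m rr j = 0 := fun j hj =>
    PluckerAux.stepPart_zero fun i hi => by
      have := hle i (n - 1) (by omega) (by omega)
      omega
  have hld : rr (d - 1) ≤ rr (n - 1) := hle _ _ (by omega) (by omega)
  have hcor := PluckerAux.stepPart_corner hm hmpos hrr hrrpos (show d - 1 < n by omega)
  have hK : rr (n - 1) < rr (n - 1) + n + 1 := by omega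
  have hcore := PluckerAux.core (K := rr (n - 1) + n + 1) hn hm hmpos hrr hrrpos hd1 hdn hK
    (fun p c => PluckerAux.V (fun k c => (k : ℂ) ^ (-(a c))) M p ((c : ℕ) : ℤ))
    (fun c => if c = 0 then 1 else 0)
  have hpl := fun t P Q =>
    @PluckerAux.pair_list n m rr hm hmpos hrr hrrpos d hdn (rr (n - 1) + n + 1) hK t P Q
  have ZA : ∀ κ : ℕ → ℕ, Antitone κ → κ 0 ≤ m 0 + 2 → (∀ j, rr (n - 1) + n ≤ j → κ j = 0) →
      zetaT M (m 0 + 2) (conjF κ (rr (n - 1) + n)) (fun _ => 0) a =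
        PluckerAux.dt (PluckerAux.xr (K := rr (n - 1) + n + 1)
          (fun p c => PluckerAux.V (fun k c => (k : ℂ) ^ (-(a c))) M p ((c : ℕ) : ℤ)) κ) :=
    fun κ h1 h2 h3 => by
      rw [PluckerAux.zetaT_eq h1 h2 h3, PluckerAux.JT_left _ h1 h3]
  have ZB : ∀ κ : ℕ → ℕ, Antitone κ → κ 0 ≤ m 0 + 2 → (∀ j, rr (n - 1) + n ≤ j → κ j = 0) →
      zetaT M (m 0 + 2) (conjF κ (rr (n - 1) + n)) (fun _ => 0) (fun c => a (c + 1)) =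
        PluckerAux.dt (PluckerAux.yr (K := rr (n - 1) + n + 1)
          (fun p c => PluckerAux.V (fun k c => (k : ℂ) ^ (-(a c))) M p ((c : ℕ) : ℤ))
          (fun c => if c = 0 then 1 else 0) κ) :=
    fun κ h1 h2 h3 => by
      rw [PluckerAux.zetaT_eq h1 h2 h3]
      exact PluckerAux.JT_shift (fun k c => (k : ℂ) ^ (-(a c))) κ _ M
  have b0 := hν0 0
  rw [ZA _ hν (by omega) hνN, ZB _ hν (by omega) hνN, hcore]
  have A1 : Antitone
      (fun i => if i < rr (d - 1) then stepPart n m rr i - 1 else stepPart n m rr i) := by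
    refine antitone_nat_of_succ_le fun i => ?_
    have h0 : stepPart n m rr (i + 1) ≤ stepPart n m rr i := hν (Nat.le_succ i)
    by_cases h1 : i + 1 < rr (d - 1)
    · rw [if_pos h1, if_pos (by omega)]
      omega
    · rw [if_neg h1]
      by_cases h2 : i < rr (d - 1)
      · rw [if_pos h2]
        have e : i + 1 = rr (d - 1) := by omega
        have h3 := hcor.2
        rw [← e, Nat.add_sub_cancel] at h3
        omega
      · rw [if_neg h2]
        exact h0
  have A2 : Antitone
      (fun i => if i < rr (d - 1) then stepPart n m rr i + 1 else stepPart n m rr i) := by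
    refine antitone_nat_of_succ_le fun i => ?_
    have h0 : stepPart n m rr (i + 1) ≤ stepPart n m rr i := hν (Nat.le_succ i)
    by_cases h1 : i + 1 < rr (d - 1)
    · rw [if_pos h1, if_pos (by omega)]
      omega
    · rw [if_neg h1]
      by_cases h2 : i < rr (d - 1)
      · rw [if_pos h2]
        omega
      · rw [if_neg h2]
        exact h0
  have ZA1 := ZA _ A1 (by rw [if_pos (by omega)]; omega)
    (fun j hj => by rw [if_neg (by omega)]; exact hνN j hj)
  have ZB1 := ZB _ A2 (by rw [if_pos (by omega)]; omega)
    (fun j hj => by rw [if_neg (by omega)]; exact hνN j hj)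
  rw [ZA1, ZB1]
  refine congrArg₂ (· + ·) rfl ?_
  refine Finset.sum_congr rfl fun t _ => ?_
  refine congrArg (fun z => (-1 : ℂ) ^ (t - 1) * z) ?_
  refine Finset.sum_congr rfl fun P hP => Finset.sum_congr rfl fun Q hQ => ?_
  obtain ⟨l, l1, l2, l3, l8, l4, l5, l6, l7⟩ := hpl t P Q hP hQ
  obtain ⟨c1, c2, c3, c4, c5⟩ := PluckerAux.chain_basic hν _ l l2 l3
  rw [← l4, ← l5, ZA _ c1, ZB _ c2]
  · have := c5 0
    omega
  · intro j hj
    have := c5 j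
    rw [hνN j hj] at this
    omega
  · have := c3 0 fun p hp => Or.inl (l3 p hp).1
    omega
  · intro j hj
    rw [c3 j fun p hp => Or.inr (by have := l8 p hp; omega), hνN j hj]
end

section
/- Evaluation of a two-row Schur multiple zeta value (first formula of the concluding Remark): Let c ≥ 0 be an integer, let λ = ((c+2)^2) be the rectangular partition with two rows of length c+2, and let s be the filling of D(λ) with s_{1,j} = 2 for all 1 ≤ j ≤ c+2, s_{2,1} = 1, and s_{2,j} = 2 for 2 ≤ j ≤ c+2. Then lim_{M→∞} ζ^M_{λ}(s) exists and equals 4(1 − 2^{−(2c+3)}) ζ(2c+3) ζ(2c+4) − 4(1 − 2^{−(2c+1)}) ζ(2c+2) ζ(2c+5), where ζ(k) := Σ_{n≥1} n^{−k} for integers k ≥ 2. -/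
open Matrix BigOperators Finset Filter

namespace TwoRow

/-- weight `(x+1)^{-2}` -/
noncomputable def w (x : ℕ) : ℂ := (((x + 1 : ℕ) : ℂ) ^ 2)⁻¹

/-- weight `(x+1)^{-1}` -/
noncomputable def w1 (x : ℕ) : ℂ := (((x + 1 : ℕ) : ℂ))⁻¹

/-- truncated `ζ⋆({2}^k)` -/
noncomputable def B : ℕ → ℕ → ℂ
  | 0, _ => 1
  | k + 1, M => ∑ x ∈ range M, w x * B k (x + 1)

/-- truncated `ζ⋆(1,{2}^k)` -/
noncomputable def A : ℕ → ℕ → ℂ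
  | 0, M => ∑ x ∈ range M, w1 x
  | k + 1, M => ∑ x ∈ range M, w x * A k (x + 1)

noncomputable def v : ℕ → ℕ → ℂ
  | 0, y => w1 y
  | k + 1, y => w y * A k (y + 1)

noncomputable def u : ℕ → ℕ → ℂ
  | 0, _ => 0
  | k + 1, y => w y * B k (y + 1)

/-- last-column refined two-row sum -/
noncomputable def F (n x y : ℕ) : ℂ := w x * (B n (x + 1) * v n y - A n (x + 1) * u n y)

lemma sum_v (n t : ℕ) : ∑ y ∈ range t, v n y = A n t := by
  cases n <;> simp [v, A]

lemma sum_u (n s t : ℕ) (h : s ≤ t) : ∑ y ∈ Ico s t, u n y = B n t - B n s := by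
  cases n with
  | zero => simp [u, B]
  | succ n => rw [Finset.sum_Ico_eq_sub _ h]; simp [u, B]

lemma sum_F (n s t : ℕ) (h : s ≤ t) :
    ∑ x ∈ range s, ∑ y ∈ range t, (if x < y then F n x y else 0) =
      B (n + 1) s * A n t - B n t * A (n + 1) s := by
  have key : ∀ x ∈ range s, ∑ y ∈ range t, (if x < y then F n x y else 0) =
      (w x * B n (x + 1)) * A n t - B n t * (w x * A n (x + 1)) := by
    intro x hx
    have hx' : x + 1 ≤ t := by have := Finset.mem_range.1 hx; omega
    rw [← Finset.sum_filter]
    have : (range t).filter (fun y => x < y) = Ico (x + 1) t := by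
      ext y; simp [Finset.mem_Ico]; omega
    rw [this]
    simp only [F, ← Finset.mul_sum, Finset.sum_sub_distrib]
    rw [sum_u _ _ _ hx', Finset.sum_Ico_eq_sub _ hx', sum_v, sum_v]
    ring
  rw [Finset.sum_congr rfl key, Finset.sum_sub_distrib, ← Finset.sum_mul, ← Finset.mul_sum]
  simp [B, A]

section chain
variable {α : Type*} [Fintype α] [PartialOrder α] [DecidableEq α]

open Classical in
/-- transfer recursion -/
noncomputable def G (g : ℕ → α → ℂ) : ℕ → α → ℂ
  | 0, a => g 0 a
  | n + 1, a => g (n + 1) a * ∑ x : α, if x ≤ a then G g n x else 0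

open Classical in
lemma chain_last (g : ℕ → α → ℂ) (n : ℕ) (a : α) :
    (∑ z : Fin (n + 1) → α, if Monotone z ∧ z (Fin.last n) = a then
      ∏ j : Fin (n + 1), g (j : ℕ) (z j) else 0) = G g n a := by
  induction n generalizing a with
  | zero =>
    rw [← (Equiv.funUnique (Fin 1) α).symm.sum_comp]
    rw [Finset.sum_eq_single a]
    · simp [G, Subsingleton.monotone]
    · intro b _ hb; simp [hb]
    · simp
  | succ n ih =>
    rw [← (Fin.snocEquiv (fun _ : Fin (n + 2) => α)).sum_comp, Fintype.sum_prod_type]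
    have mono : ∀ (b : α) (z : Fin (n + 1) → α),
        Monotone (Fin.snoc z b : Fin (n + 2) → α) ↔ Monotone z ∧ z (Fin.last n) ≤ b := by
      intro b z
      rw [Fin.monotone_iff_le_succ, Fin.forall_fin_succ', Fin.monotone_iff_le_succ]
      refine and_congr (forall_congr' fun i => ?_) ?_
      · rw [Fin.snoc_castSucc, Fin.succ_castSucc, Fin.snoc_castSucc]
      · rw [Fin.snoc_castSucc, Fin.succ_last, Fin.snoc_last]
    rw [Finset.sum_eq_single a]
    · simp only [G, ← ih]
      rw [Finset.mul_sum]
      have : ∀ x : α, g (n+1) a * (if x ≤ a then (∑ z : Fin (n + 1) → α,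
          if Monotone z ∧ z (Fin.last n) = x then ∏ j : Fin (n + 1), g (j : ℕ) (z j) else 0) else 0) =
          ∑ z : Fin (n + 1) → α, if z (Fin.last n) = x then
            (if Monotone z ∧ z (Fin.last n) ≤ a then
             (∏ j : Fin (n + 1), g (j : ℕ) (z j)) * g (n+1) a else 0) else 0 := by
        intro x
        split_ifs with hx
        · rw [Finset.mul_sum]
          refine Finset.sum_congr rfl fun z _ => ?_
          by_cases h : z (Fin.last n) = x
          · subst h; by_cases h2 : Monotone z <;> simp [h2, hx, mul_comm]
          · simp [h]
        · rw [mul_zero]; symm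
          refine Finset.sum_eq_zero fun z _ => ?_
          by_cases h : z (Fin.last n) = x
          · subst h; simp [hx]
          · simp [h]
      rw [Finset.sum_congr rfl fun x _ => this x, Finset.sum_comm]
      refine Finset.sum_congr rfl fun z _ => ?_
      rw [Finset.sum_ite_eq Finset.univ (z (Fin.last n))]
      simp only [Fin.snocEquiv, Equiv.coe_fn_mk, Finset.mem_univ, if_true]
      simp only [mono, Fin.snoc_last, and_true, Fin.prod_univ_castSucc, Fin.snoc_castSucc,
        Fin.val_castSucc, Fin.val_last]
    · intro b _ hb
      refine Finset.sum_eq_zero fun z _ => ?_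
      simp [Fin.snocEquiv, hb]
    · simp

open Classical in
lemma chain_total (g : ℕ → α → ℂ) (n : ℕ) :
    (∑ z : Fin (n + 1) → α, if Monotone z then ∏ j : Fin (n + 1), g (j : ℕ) (z j) else 0) =
      ∑ a, G g n a := by
  simp only [← chain_last]
  rw [Finset.sum_comm]
  refine Finset.sum_congr rfl fun z _ => ?_
  by_cases h : Monotone z <;> simp [h]

end chain

/-- column weights -/
noncomputable def gcol (M : ℕ) (j : ℕ) (a : Fin M × Fin M) : ℂ :=
  if a.1 < a.2 then w a.1 * (if j = 0 then w1 a.2 else w a.2) else 0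

lemma fin_sum_le (M : ℕ) (a : Fin M) (h : ℕ → ℂ) :
    (∑ x : Fin M, if x ≤ a then h x else 0) = ∑ x ∈ range (a + 1), h x := by
  have : ∀ x : Fin M, (if x ≤ a then h x else 0) = (fun n : ℕ => if n ≤ a then h n else 0) x := by
    intro x; rfl
  rw [Finset.sum_congr rfl fun x _ => this x, Fin.sum_univ_eq_sum_range
    (fun n : ℕ => if n ≤ a then h n else 0) M, ← Finset.sum_filter]
  congr 1
  ext y; simp; omega

lemma G_eq (M n : ℕ) (a : Fin M × Fin M) :
    G (gcol M) n a = if (a.1 : ℕ) < (a.2 : ℕ) then F n a.1 a.2 else 0 := by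
  induction n generalizing a with
  | zero => simp [G, gcol, F, B, u, v]
  | succ n ih =>
    obtain ⟨a, b⟩ := a
    simp only [G, gcol, Fin.lt_def]
    split_ifs with h
    · exact absurd ‹_› (by simp)
    · have : (∑ x : Fin M × Fin M, if x ≤ (a, b) then G (gcol M) n x else 0) =
          ∑ x ∈ range (a + 1 : ℕ), ∑ y ∈ range (b + 1 : ℕ), (if x < y then F n x y else 0) := by
        rw [Fintype.sum_prod_type, ← fin_sum_le]
        refine Finset.sum_congr rfl fun x _ => ?_
        rw [← fin_sum_le]
        by_cases hx : x ≤ a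
        · simp [hx, Prod.le_def, ih]
        · simp [hx, Prod.le_def]
      rw [sum_F _ _ _ (by omega)] at this
      trans w a * w b * (B (n + 1) (a + 1) * A n (b + 1) - B n (b + 1) * A (n + 1) (a + 1))
      · rw [← this]; congr!
      simp only [F, u, v]
      ring
    · simp

end TwoRow

namespace TwoRow

/-- `C M m = M!² / ((M-m)! (M+m)!)` as a product. -/
noncomputable def C (M m : ℕ) : ℝ :=
  if m ≤ M then (M.factorial : ℝ) ^ 2 / ((M - m).factorial * (M + m).factorial) else 0

lemma C_nonneg (M m : ℕ) : 0 ≤ C M m := by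
  unfold C; split_ifs <;> positivity

lemma C_succ_right (M m : ℕ) : (M + m + 1) * C M (m + 1) = (M - m) * C M m := by
  unfold C
  rcases lt_trichotomy m M with h | h | h
  · obtain ⟨k, rfl⟩ := Nat.exists_eq_add_of_lt h
    have h1 : m + k + 1 - (m + 1) = k := by omega
    have h2 : m + k + 1 - m = k + 1 := by omega
    rw [if_pos (by omega), if_pos (by omega), h1, h2, ← add_assoc (m + k + 1) m 1,
      Nat.factorial_succ (m + k + 1 + m), Nat.factorial_succ k]
    push_cast
    field_simp
    ring
  · subst h; simp
  · rw [if_neg (by omega), if_neg (by omega)]; simp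

lemma C_succ_left (M m : ℕ) :
    C (M + 1) m - C M m = (m : ℝ) ^ 2 / ((M + 1 : ℕ) : ℝ) ^ 2 * C (M + 1) m := by
  unfold C
  rcases lt_trichotomy m (M + 1) with h | h | h
  · obtain ⟨k, rfl⟩ := Nat.exists_eq_add_of_le (Nat.lt_succ_iff.1 h)
    have h1 : m + k + 1 - m = k + 1 := by omega
    have h2 : m + k - m = k := by omega
    have h3 : m + k + 1 + m = (m + k + m) + 1 := by omega
    rw [if_pos (by omega), if_pos (by omega), h1, h2, h3,
      Nat.factorial_succ (m + k + m), Nat.factorial_succ k, Nat.factorial_succ (m + k)]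
    push_cast
    field_simp
    ring
  · subst h
    rw [if_pos le_rfl, if_neg (by omega)]
    push_cast
    field_simp
    ring
  · rw [if_neg (by omega), if_neg (by omega)]; simp

lemma C_zero (M : ℕ) : C M 0 = 1 := by
  unfold C; simp; field_simp

lemma C_gt (M m : ℕ) (h : M < m) : C M m = 0 := by
  unfold C; rw [if_neg (by omega)]

lemma C_le_one (M m : ℕ) : C M m ≤ 1 := by
  induction m with
  | zero => rw [C_zero]
  | succ m ih =>
    by_cases h : M < m + 1
    · rw [C_gt _ _ h]; norm_num
    · have := C_succ_right M m
      have h0 := C_nonneg M m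
      have hm : (0:ℝ) ≤ m := by positivity
      have hM : (0:ℝ) ≤ M := by positivity
      by_contra hc
      push Not at hc
      nlinarith

lemma C_tendsto (m : ℕ) : Tendsto (fun M => C M m) atTop (nhds 1) := by
  induction m with
  | zero => simp [C_zero]
  | succ m ih =>
    have h1 : ∀ M : ℕ, C M (m + 1) = (1 - (2 * m + 1 : ℝ) / ((M : ℝ) + (m + 1))) * C M m := by
      intro M
      have := C_succ_right M m
      have hp : (0:ℝ) < (M : ℝ) + (m + 1) := by positivity
      field_simp
      linarith
    simp only [h1]
    have : Tendsto (fun M : ℕ => (2 * m + 1 : ℝ) / ((M : ℝ) + (m + 1))) atTop (nhds 0) :=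
      Tendsto.div_atTop tendsto_const_nhds
        (tendsto_atTop_add_const_right _ _ tendsto_natCast_atTop_atTop)
    have h2 := (tendsto_const_nhds (x := (1:ℝ))).sub this
    simpa using h2.mul ih

/-- generic sum `2 Σ_{m=1}^{M} ε(m) C_M(m) / m^s`, indexed from zero -/
noncomputable def S (e : ℝ) (M s : ℕ) : ℝ :=
  2 * ∑ m ∈ range M, e ^ m * C M (m + 1) / ((m + 1 : ℕ) : ℝ) ^ s

lemma S_step (e : ℝ) (M s : ℕ) :
    S e (M + 1) (s + 2) - S e M (s + 2) = (((M + 1 : ℕ) : ℝ) ^ 2)⁻¹ * S e (M + 1) s := by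
  have h : ∑ m ∈ range M, e ^ m * C M (m + 1) / ((m + 1 : ℕ) : ℝ) ^ (s + 2) =
      ∑ m ∈ range (M + 1), e ^ m * C M (m + 1) / ((m + 1 : ℕ) : ℝ) ^ (s + 2) := by
    rw [Finset.sum_range_succ, C_gt M (M + 1) (by omega)]; simp
  unfold S
  rw [h, ← mul_sub, ← Finset.sum_sub_distrib, mul_left_comm]
  congr 1
  rw [Finset.mul_sum]
  refine Finset.sum_congr rfl fun m _ => ?_
  have := C_succ_left M (m + 1)
  rw [← sub_div, ← mul_sub, this]
  have : ((m + 1 : ℕ) : ℝ) ≠ 0 := by positivity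
  field_simp
  ring

lemma S_base_one (M : ℕ) : ∑ m ∈ range (M + 1), ((m + 1 : ℕ) : ℝ) * C (M + 1) (m + 1) = (M + 1 : ℝ) / 2 := by
  have key : ∀ n, ∑ m ∈ range n, ((m + 1 : ℕ) : ℝ) * C (M + 1) (m + 1) =
      (M + 1 : ℝ) / 2 - (M + 1 - n) / 2 * C (M + 1) n := by
    intro n
    induction n with
    | zero => simp [C_zero]
    | succ n ih =>
      rw [Finset.sum_range_succ, ih]
      have := C_succ_right (M + 1) n
      push_cast at *
      linear_combination (1 / 2) * this
  rw [key]; push_cast; ring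

lemma S_base_two (M : ℕ) : ∑ m ∈ range (M + 1), (-1 : ℝ) ^ m * C (M + 1) (m + 1) = 1 / 2 := by
  have key : ∀ n, (M + 1 : ℝ) * ∑ m ∈ range n, (-1 : ℝ) ^ m * C (M + 1) (m + 1) =
      (M + 1 : ℝ) / 2 - (-1) ^ n * (M + 1 - n) / 2 * C (M + 1) n := by
    intro n
    induction n with
    | zero => simp [C_zero]
    | succ n ih =>
      rw [Finset.sum_range_succ, mul_add, ih, pow_succ]
      have := C_succ_right (M + 1) n
      push_cast at *
      linear_combination ((-1) ^ n / 2) * this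
  have h := key (M + 1)
  have hp : (M + 1 : ℝ) ≠ 0 := by positivity
  apply mul_left_cancel₀ hp
  rw [h]; push_cast; ring

lemma A_eq (k M : ℕ) : A k M = ((S 1 M (2 * k + 1) : ℝ) : ℂ) := by
  induction k generalizing M with
  | zero =>
    simp only [A]
    induction M with
    | zero => simp [S]
    | succ M ih =>
      rw [Finset.sum_range_succ, ih]
      have h : S 1 (M + 1) 1 - S 1 M 1 = (((M + 1 : ℕ) : ℝ))⁻¹ := by
        have h : ∑ m ∈ range M, (1:ℝ) ^ m * C M (m + 1) / ((m + 1 : ℕ) : ℝ) ^ 1 =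
            ∑ m ∈ range (M + 1), (1:ℝ) ^ m * C M (m + 1) / ((m + 1 : ℕ) : ℝ) ^ 1 := by
          rw [Finset.sum_range_succ, C_gt M (M + 1) (by omega)]; simp
        unfold S
        rw [h, ← mul_sub, ← Finset.sum_sub_distrib]
        have h2 : ∀ m ∈ range (M + 1), (1:ℝ) ^ m * C (M + 1) (m + 1) / ((m + 1 : ℕ) : ℝ) ^ 1 -
            (1:ℝ) ^ m * C M (m + 1) / ((m + 1 : ℕ) : ℝ) ^ 1 =
            (((M + 1 : ℕ) : ℝ) ^ 2)⁻¹ * (((m + 1 : ℕ) : ℝ) * C (M + 1) (m + 1)) := by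
          intro m _
          have h3 := C_succ_left M (m + 1)
          rw [← sub_div, ← mul_sub, h3]
          have : ((m + 1 : ℕ) : ℝ) ≠ 0 := by positivity
          field_simp
          simp
        rw [Finset.sum_congr rfl h2, ← Finset.mul_sum, S_base_one]
        push_cast
        field_simp
      have h' : S 1 (M + 1) (2 * 0 + 1) = S 1 M (2 * 0 + 1) + (((M + 1 : ℕ) : ℝ))⁻¹ := by
        simp only [mul_zero, zero_add]; linarith
      rw [h']; simp [w1]
  | succ k ih =>
    simp only [A, ih]
    induction M with
    | zero => simp [S]
    | succ M ihM =>
      rw [Finset.sum_range_succ, ihM]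
      have h := S_step 1 M (2 * k + 1)
      have h' : S 1 (M + 1) (2 * (k + 1) + 1) = S 1 M (2 * (k + 1) + 1) +
        (((M + 1 : ℕ) : ℝ) ^ 2)⁻¹ * S 1 (M + 1) (2 * k + 1) := by
        have : 2 * (k + 1) + 1 = 2 * k + 1 + 2 := by ring
        rw [this]; linarith
      rw [h']; simp [w]

lemma B_eq (k M : ℕ) : B (k + 1) M = ((S (-1) M (2 * (k + 1)) : ℝ) : ℂ) := by
  induction k generalizing M with
  | zero =>
    simp only [B]
    induction M with
    | zero => simp [S]
    | succ M ihM =>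
      rw [Finset.sum_range_succ, ihM]
      have h := S_step (-1) M 0
      have h0 : S (-1) (M + 1) 0 = 1 := by
        unfold S; simp only [pow_zero, div_one]; rw [S_base_two]; norm_num
      have h' : S (-1) (M + 1) (2 * (0 + 1)) = S (-1) M (2 * (0 + 1)) +
        (((M + 1 : ℕ) : ℝ) ^ 2)⁻¹ := by
        rw [h0] at h
        simp only [zero_add, mul_one] at *; linarith
      rw [h']; simp [w]
  | succ k ih =>
    rw [B]
    simp only [ih]
    induction M with
    | zero => simp [S]
    | succ M ihM =>
      rw [Finset.sum_range_succ, ihM]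
      have h := S_step (-1) M (2 * (k + 1))
      have h' : S (-1) (M + 1) (2 * (k + 1 + 1)) = S (-1) M (2 * (k + 1 + 1)) +
        (((M + 1 : ℕ) : ℝ) ^ 2)⁻¹ * S (-1) (M + 1) (2 * (k + 1)) := by
        have : 2 * (k + 1 + 1) = 2 * (k + 1) + 2 := by ring
        rw [this]; linarith
      rw [h']; simp [w]

lemma summ (s : ℕ) (hs : 2 ≤ s) : Summable fun m : ℕ => 1 / ((m + 1 : ℕ) : ℝ) ^ s :=
  (summable_nat_add_iff 1).2 (Real.summable_one_div_nat_pow.2 (by omega))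

lemma S_tendsto (e : ℝ) (he : |e| = 1) (s : ℕ) (hs : 2 ≤ s) :
    Tendsto (fun M => S e M s) atTop (nhds (2 * ∑' m : ℕ, e ^ m / ((m + 1 : ℕ) : ℝ) ^ s)) := by
  have h1 : ∀ M, S e M s = 2 * ∑' m : ℕ, e ^ m * C M (m + 1) / ((m + 1 : ℕ) : ℝ) ^ s := by
    intro M
    unfold S
    rw [tsum_eq_sum (s := range M)]
    intro m hm
    rw [C_gt M (m + 1) (by simp at hm; omega)]; simp
  simp only [h1]
  refine Tendsto.const_mul _ ?_
  refine tendsto_tsum_of_dominated_convergence (summ s hs) ?_ ?_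
  · intro m
    have := ((C_tendsto (m + 1)).const_mul (e ^ m)).div_const (((m + 1 : ℕ) : ℝ) ^ s)
    simpa using this
  · refine Eventually.of_forall fun M m => ?_
    rw [Real.norm_eq_abs, abs_div, abs_mul, abs_pow, he, one_pow, one_mul,
      abs_of_nonneg (C_nonneg _ _), abs_of_nonneg (by positivity : (0:ℝ) ≤ ((m + 1 : ℕ) : ℝ) ^ s)]
    gcongr
    exact C_le_one _ _

lemma zetaVal_eq (s : ℕ) : zetaVal s = ((∑' m : ℕ, 1 / ((m + 1 : ℕ) : ℝ) ^ s : ℝ) : ℂ) := by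
  unfold zetaVal
  rw [Complex.ofReal_tsum]
  refine tsum_congr fun n => ?_
  simp [_root_.zpow_neg]

lemma eta_eq (s : ℕ) (hs : 2 ≤ s) : ∑' m : ℕ, (-1 : ℝ) ^ m / ((m + 1 : ℕ) : ℝ) ^ s =
    (1 - 2 / 2 ^ s) * ∑' m : ℕ, 1 / ((m + 1 : ℕ) : ℝ) ^ s := by
  have hsum := summ s hs
  have he : Summable fun m : ℕ => 1 / ((2 * m + 1 : ℕ) : ℝ) ^ s :=
    hsum.comp_injective (i := fun m : ℕ => 2 * m) (fun a b h => by simpa using h)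
  have ho : Summable fun m : ℕ => 1 / ((2 * m + 1 + 1 : ℕ) : ℝ) ^ s :=
    hsum.comp_injective (i := fun m : ℕ => 2 * m + 1) (fun a b h => by simpa using h)
  have h1 := tsum_even_add_odd (f := fun m : ℕ => 1 / ((m + 1 : ℕ) : ℝ) ^ s) he ho
  have h2 := tsum_even_add_odd (f := fun m : ℕ => (-1 : ℝ) ^ m / ((m + 1 : ℕ) : ℝ) ^ s)
    (by simpa [pow_mul] using he) (by
      have := ho.neg
      refine this.congr fun m => ?_
      rw [pow_succ, pow_mul]; simp [neg_div])
  have h3 : ∑' m : ℕ, 1 / ((2 * m + 1 + 1 : ℕ) : ℝ) ^ s =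
      1 / 2 ^ s * ∑' m : ℕ, 1 / ((m + 1 : ℕ) : ℝ) ^ s := by
    rw [← tsum_mul_left]
    refine tsum_congr fun m => ?_
    have : ((2 * m + 1 + 1 : ℕ) : ℝ) = 2 * ((m + 1 : ℕ) : ℝ) := by push_cast; ring
    rw [this, mul_pow]; field_simp
  have h4 : ∀ m : ℕ, (-1 : ℝ) ^ (2 * m + 1) / ((2 * m + 1 + 1 : ℕ) : ℝ) ^ s =
      - (1 / ((2 * m + 1 + 1 : ℕ) : ℝ) ^ s) := by
    intro m; rw [pow_succ, pow_mul]; simp [neg_div]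
  have h5 : ∀ m : ℕ, (-1 : ℝ) ^ (2 * m) / ((2 * m + 1 : ℕ) : ℝ) ^ s =
      (1 / ((2 * m + 1 : ℕ) : ℝ) ^ s) := by
    intro m; rw [pow_mul]; simp
  simp only [h4, h5, tsum_neg] at h2
  rw [← h2]
  rw [h3] at h1 ⊢
  linear_combination h1

lemma A_tendsto (k : ℕ) : Tendsto (A (k + 1)) atTop (nhds (2 * zetaVal (2 * k + 3))) := by
  have h := S_tendsto 1 (by simp) (2 * (k + 1) + 1) (by omega)
  have h2 := (Complex.continuous_ofReal.tendsto _).comp h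
  refine Tendsto.congr' (Eventually.of_forall fun M => (A_eq (k + 1) M).symm) ?_
  rw [zetaVal_eq]
  convert h2 using 1
  congr 1
  simp only [one_pow]
  push_cast
  rfl

lemma B_tendsto (k : ℕ) : Tendsto (B (k + 1)) atTop
    (nhds (2 * (1 - (2 : ℂ) ^ (-(2 * (k : ℤ) + 1))) * zetaVal (2 * k + 2))) := by
  have h := S_tendsto (-1) (by simp) (2 * (k + 1)) (by omega)
  have h2 := (Complex.continuous_ofReal.tendsto _).comp h
  refine Tendsto.congr' (Eventually.of_forall fun M => (B_eq k M).symm) ?_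
  rw [zetaVal_eq]
  convert h2 using 1
  congr 1
  rw [eta_eq _ (by omega), show 2 * (k + 1) = 2 * k + 2 by ring, Complex.ofReal_mul,
    Complex.ofReal_mul, mul_assoc]
  have : (2 : ℂ) ^ (-(2 * (k : ℤ) + 1)) = 2 / 2 ^ (2 * k + 2) := by
    have h : (2 * (k : ℤ) + 1) = ((2 * k + 1 : ℕ) : ℤ) := by push_cast; ring
    rw [_root_.zpow_neg, h, zpow_natCast, pow_succ _ (2 * k + 1)]
    field_simp
  rw [this]
  push_cast
  rfl

end TwoRow

namespace TwoRow

/-- the cells of the two-row rectangle -/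
def cellEquiv (c : ℕ) : Fin 2 × Fin (c + 2) ≃
    ↥(cellsD 2 (fun i => if i < 2 then c + 2 else 0) (fun _ => 0)) where
  toFun p := ⟨(p.1, p.2), by
    have h1 := p.1.2
    have h2 := p.2.2
    simp only [cellsD, Finset.mem_filter, Finset.mem_product, Finset.mem_range]
    rw [if_pos h1]
    simp
    omega⟩
  invFun q := ⟨⟨q.1.1, by
    have := q.2
    simp only [cellsD, Finset.mem_filter, Finset.mem_product, Finset.mem_range] at this
    omega⟩, ⟨q.1.2, by
    have := q.2
    simp only [cellsD, Finset.mem_filter, Finset.mem_product, Finset.mem_range] at this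
    have h := this.2.2
    rw [if_pos this.1.1] at h
    exact h⟩⟩
  left_inv p := rfl
  right_inv q := rfl

/-- fillings as sequences of columns -/
def colEquiv (c M : ℕ) : (Fin (c + 2) → Fin M × Fin M) ≃
    (↥(cellsD 2 (fun i => if i < 2 then c + 2 else 0) (fun _ => 0)) → Fin M) where
  toFun z q := if q.1.1 = 0 then (z ((cellEquiv c).symm q).2).1 else (z ((cellEquiv c).symm q).2).2
  invFun T j := (T (cellEquiv c (0, j)), T (cellEquiv c (1, j)))
  left_inv z := by
    funext j
    simp [cellEquiv]
  right_inv T := by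
    funext q
    obtain ⟨⟨i, j⟩, rfl⟩ := (cellEquiv c).surjective q
    fin_cases i <;> simp [cellEquiv]

lemma col_apply_zero (c M : ℕ) (z : Fin (c + 2) → Fin M × Fin M) (j : Fin (c + 2)) :
    colEquiv c M z (cellEquiv c (0, j)) = (z j).1 := by
  simp [colEquiv, cellEquiv]

lemma col_apply_one (c M : ℕ) (z : Fin (c + 2) → Fin M × Fin M) (j : Fin (c + 2)) :
    colEquiv c M z (cellEquiv c (1, j)) = (z j).2 := by
  simp [colEquiv, cellEquiv]

lemma isSSYT_iff (c M : ℕ) (z : Fin (c + 2) → Fin M × Fin M) :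
    IsSSYT (colEquiv c M z) ↔ Monotone z ∧ ∀ j, (z j).1 < (z j).2 := by
  unfold IsSSYT
  rw [(cellEquiv c).surjective.forall₂, (cellEquiv c).surjective.forall₂]
  simp only [Prod.forall, Fin.forall_fin_two, col_apply_zero, col_apply_one]
  simp only [cellEquiv, Equiv.coe_fn_mk, Fin.val_zero, Fin.val_one]
  constructor
  · rintro ⟨h1, h2⟩
    refine ⟨fun i j hij => ⟨?_, ?_⟩, fun j => ?_⟩
    · exact (h1.1 i).1 j trivial hij
    · exact (h1.2 i).2 j trivial hij
    · exact (h2.1 j).2 j (by norm_num) rfl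
  · rintro ⟨h1, h2⟩
    refine ⟨⟨fun i => ⟨fun j _ h => (h1 h).1, fun j h => by omega⟩,
      fun i => ⟨fun j h => by omega, fun j _ h => (h1 h).2⟩⟩,
      ⟨fun i => ⟨fun j h => by omega, fun j _ h => ?_⟩,
      fun i => ⟨fun j h => by omega, fun j h => by omega⟩⟩⟩
    obtain rfl : i = j := Fin.ext h
    exact h2 i

lemma cpow_two (k : ℕ) : (((k + 1 : ℕ)) : ℂ) ^ (-(2 : ℂ)) = w k := by
  rw [Complex.cpow_neg, Complex.cpow_ofNat]; rfl

lemma cpow_one' (k : ℕ) : (((k + 1 : ℕ)) : ℂ) ^ (-(1 : ℂ)) = w1 k := by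
  rw [Complex.cpow_neg, Complex.cpow_one]; rfl

lemma zetaTF_eq (c M : ℕ) :
    zetaTF M 2 (fun i => if i < 2 then c + 2 else 0) (fun _ => 0)
          (fun cc => if cc.1 = 0 then (2 : ℂ) else (if cc.2 = 0 then 1 else 2)) =
      B (c + 2) M * A (c + 1) M - B (c + 1) M * A (c + 2) M := by
  classical
  rw [← sum_F (c + 1) M M le_rfl]
  unfold zetaTF tabSum
  rw [Finset.sum_filter, ← (colEquiv c M).sum_comp]
  trans ∑ z : Fin (c + 1 + 1) → Fin M × Fin M,
    if Monotone z then ∏ j : Fin (c + 1 + 1), gcol M (j : ℕ) (z j) else 0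
  · refine Finset.sum_congr rfl fun z _ => ?_
    simp only [isSSYT_iff]
    by_cases hm : Monotone z
    · by_cases hz : ∀ j, (z j).1 < (z j).2
      · rw [if_pos ⟨hm, hz⟩, if_pos hm, ← (cellEquiv c).prod_comp, Fintype.prod_prod_type,
          Fin.prod_univ_two, ← Finset.prod_mul_distrib]
        refine Finset.prod_congr rfl fun j _ => ?_
        rw [col_apply_zero, col_apply_one]
        simp only [gcol, if_pos (hz j)]
        simp only [cellEquiv, Equiv.coe_fn_mk, Fin.val_zero, Fin.val_one, if_true]
        rw [cpow_two]
        congr 1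
        by_cases hj : (j : ℕ) = 0
        · simp only [hj, if_true, one_ne_zero, if_false]; exact cpow_one' _
        · simp only [hj, one_ne_zero, if_false]; exact cpow_two _
      · rw [if_neg (fun h => hz h.2), if_pos hm]
        push Not at hz
        obtain ⟨j, hj⟩ := hz
        symm
        refine Finset.prod_eq_zero (Finset.mem_univ j) ?_
        simp only [gcol]
        rw [if_neg (not_lt.2 hj)]
    · rw [if_neg (fun h => hm h.1), if_neg hm]
  · have := chain_total (gcol M) (c + 1)
    trans ∑ a, G (gcol M) (c + 1) a
    · rw [← this]; congr!
    · simp only [G_eq]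
      rw [Fintype.sum_prod_type, ← Fin.sum_univ_eq_sum_range
        (fun x => ∑ y ∈ range M, if x < y then F (c + 1) x y else 0)]
      refine Finset.sum_congr rfl fun x _ => ?_
      rw [← Fin.sum_univ_eq_sum_range (fun y => if (x : ℕ) < y then F (c + 1) x y else 0)]

end TwoRow

/-- Evaluation of a two-row Schur multiple zeta value (first formula of the
concluding Remark). -/
theorem two_row_schur_zeta_eval_one (c : ℕ) :
    Filter.Tendsto
        (fun M => zetaTF M 2 (fun i => if i < 2 then c + 2 else 0) (fun _ => 0)
          (fun cc => if cc.1 = 0 then (2 : ℂ) else (if cc.2 = 0 then 1 else 2)))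
        Filter.atTop
        (nhds (4 * (1 - (2 : ℂ) ^ (-(2 * (c : ℤ) + 3))) * zetaVal (2 * c + 3) *
            zetaVal (2 * c + 4) -
          4 * (1 - (2 : ℂ) ^ (-(2 * (c : ℤ) + 1))) * zetaVal (2 * c + 2) *
            zetaVal (2 * c + 5))) := by
  simp only [TwoRow.zetaTF_eq]
  have h1 := (TwoRow.B_tendsto (c + 1)).mul (TwoRow.A_tendsto c)
  have h2 := (TwoRow.B_tendsto c).mul (TwoRow.A_tendsto (c + 1))
  have h := h1.sub h2
  convert h using 2
  have e1 : -(2 * ((c + 1 : ℕ) : ℤ) + 1) = -(2 * (c : ℤ) + 3) := by push_cast; ring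
  have e2 : 2 * (c + 1) + 2 = 2 * c + 4 := by ring
  have e3 : 2 * (c + 1) + 3 = 2 * c + 5 := by ring
  rw [e1, e2, e3]
  ring
end

section
/- Evaluation of a two-row Schur multiple zeta value (second formula of the concluding Remark): Let c ≥ 0 be an integer, let λ = ((c+3)^2) be the rectangular partition with two rows of length c+3, and let s be the filling of D(λ) with s_{1,1} = 1 and s_{1,j} = 2 for 2 ≤ j ≤ c+3 in the first row, and s_{2,1} = s_{2,2} = 1 and s_{2,j} = 2 for 3 ≤ j ≤ c+3 in the second row. Then lim_{M→∞} ζ^M_{λ}(s) exists and equals 8(ζ^⋆(1, 2c+3) ζ(2c+5) − ζ^⋆(1, 2c+5) ζ(2c+3)) − 4(ζ(2c+4) ζ(2c+5) − ζ(2c+3) ζ(2c+6)), where ζ(k) := Σ_{n≥1} n^{−k} and ζ^⋆(1,k) := Σ_{1 ≤ m ≤ n} m^{−1} n^{−k}. -/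
open Matrix BigOperators Finset Filter

/-- Star sum: weakly increasing sequences of length `n` in `1..M`. -/
noncomputable def starS (w : ℕ → ℕ → ℂ) : ℕ → ℕ → ℂ
  | 0, _ => 1
  | n + 1, M => ∑ m ∈ Finset.range M, w n (m + 1) * starS w n (m + 1)

theorem starS_succ (w : ℕ → ℕ → ℂ) (n M : ℕ) :
    starS w (n + 1) (M + 1) = starS w (n + 1) M + w n (M + 1) * starS w n (M + 1) := by
  simp [starS, Finset.sum_range_succ]

theorem starS_zero_right (w : ℕ → ℕ → ℂ) (n : ℕ) : starS w (n + 1) 0 = 0 := by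
  simp [starS]

/-- `M!^2 / ((M-k)! (M+k)!)`. -/
noncomputable def gC (M : ℕ) : ℕ → ℂ
  | 0 => 1
  | k + 1 => gC M k * (((M : ℂ) - k) / ((M : ℂ) + k + 1))

theorem gC_zero_of_lt (M : ℕ) : ∀ k, M < k → gC M k = 0
  | 0, h => by omega
  | k + 1, h => by
    rcases Nat.lt_succ_iff_lt_or_eq.1 h with h1 | h1
    · simp [gC, gC_zero_of_lt M k h1]
    · subst h1; simp [gC]

theorem cast_ne (a b : ℕ) : ((a : ℂ) + b + 1) ≠ 0 := by
  exact_mod_cast Nat.succ_ne_zero (a + b)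

theorem gC_step (M k : ℕ) :
    gC M (k + 1) * ((M : ℂ) + k + 1) = gC M k * ((M : ℂ) - k) := by
  have := cast_ne M k
  simp only [gC]; field_simp

theorem gC_rec (M : ℕ) : ∀ k : ℕ,
    ((M : ℂ) + 1 - k) * ((M : ℂ) + 1 + k) * gC (M + 1) k = ((M : ℂ) + 1) ^ 2 * gC M k
  | 0 => by simp [gC]; ring
  | k + 1 => by
    have ih := gC_rec M k
    have h1 := gC_step M k
    have h2 := gC_step (M + 1) k
    have h3 := cast_ne M k
    apply mul_right_cancel₀ h3
    push_cast at *
    linear_combination ((M : ℂ) - k) * ((M:ℂ) + k + 1) * h2 + ((M : ℂ) - k) * ih - ((M : ℂ) + 1) ^ 2 * h1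

theorem gC_norm_le (M : ℕ) : ∀ k, ‖gC M k‖ ≤ 1
  | 0 => by simp [gC]
  | k + 1 => by
    have ih := gC_norm_le M k
    rw [gC, norm_mul]
    refine mul_le_one₀ ih (norm_nonneg _) ?_
    rw [norm_div]
    apply div_le_one_of_le₀ _ (norm_nonneg _)
    have e : ‖((M : ℂ) + k + 1)‖ = (M : ℝ) + k + 1 := by
      have := Complex.norm_natCast (M + k + 1)
      push_cast at this; exact this
    rw [e]
    refine (norm_sub_le _ _).trans ?_
    simp

theorem gC_tendsto : ∀ k, Tendsto (fun M => gC M k) atTop (nhds 1)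
  | 0 => by simp [gC]
  | k + 1 => by
    have ih := gC_tendsto k
    have h : Tendsto (fun M : ℕ => (((M : ℂ) - k) / ((M : ℂ) + k + 1))) atTop (nhds 1) := by
      have h1 : Tendsto (fun M : ℕ => (1 : ℂ) - (2 * k + 1) * (((M + (k + 1) : ℕ) : ℂ))⁻¹) atTop
          (nhds (1 - (2 * k + 1) * 0)) := by
        refine tendsto_const_nhds.sub (tendsto_const_nhds.mul ?_)
        exact (tendsto_add_atTop_iff_nat (f := fun n : ℕ => ((n : ℂ))⁻¹) (k + 1)).2
          (tendsto_inv_atTop_nhds_zero_nat (𝕜 := ℂ))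
      simp only [mul_zero, sub_zero] at h1
      refine h1.congr fun M => ?_
      have := cast_ne M k
      push_cast
      rw [← add_assoc]
      field_simp; ring
    simpa [gC] using ih.mul h

noncomputable def gSum (φ : ℕ → ℂ) (M : ℕ) : ℂ := 2 * ∑ k ∈ Finset.range M, gC M (k + 1) * φ (k + 1)

theorem gSum_ext (φ : ℕ → ℂ) (M : ℕ) :
    gSum φ M = 2 * ∑ k ∈ Finset.range (M + 1), gC M (k + 1) * φ (k + 1) := by
  rw [gSum, Finset.sum_range_succ, gC_zero_of_lt M (M + 1) (by omega)]; simp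

theorem gSum_diff (φ ψ : ℕ → ℂ) (h : ∀ k : ℕ, φ (k + 1) = ((k : ℂ) + 1) ^ 2 * ψ (k + 1)) (M : ℕ) :
    gSum ψ (M + 1) = gSum ψ M + gSum φ (M + 1) / ((M : ℂ) + 1) ^ 2 := by
  have h0 : ((M : ℂ) + 1) ≠ 0 := by exact_mod_cast Nat.succ_ne_zero M
  rw [gSum_ext ψ M, gSum, gSum, mul_div_assoc, ← mul_add, Finset.sum_div,
    ← Finset.sum_add_distrib]
  congr 1
  refine Finset.sum_congr rfl fun k _ => ?_
  rw [h]
  have := gC_rec M (k + 1)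
  push_cast at this
  field_simp
  linear_combination (ψ (k + 1)) * this

theorem gSum_step (w : ℕ → ℕ → ℂ) (n : ℕ) (φ ψ : ℕ → ℂ)
    (h : ∀ k : ℕ, φ (k + 1) = ((k : ℂ) + 1) ^ 2 * ψ (k + 1))
    (hw : ∀ m : ℕ, w n (m + 1) = (((m : ℂ) + 1) ^ 2)⁻¹)
    (ih : ∀ M, starS w n (M + 1) = gSum φ (M + 1)) (M : ℕ) : starS w (n + 1) M = gSum ψ M := by
  induction M with
  | zero => simp [starS, gSum]
  | succ M hM => rw [starS_succ, gSum_diff φ ψ h, hM, hw, ih]; ring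

noncomputable def har (k : ℕ) : ℂ := ∑ m ∈ Finset.range k, ((m : ℂ) + 1)⁻¹

theorem har_succ (k : ℕ) : har (k + 1) = har k + ((k : ℂ) + 1)⁻¹ := by
  simp [har, Finset.sum_range_succ]

/-- telescoping -/
theorem tele1 (M N : ℕ) : 2 * ∑ k ∈ Finset.range N, gC M (k + 1) * ((k : ℂ) + 1) =
    M - gC M N * (M - N) := by
  induction N with
  | zero => simp [gC]
  | succ N ih =>
    rw [Finset.sum_range_succ, mul_add, ih]
    have := gC_step M N
    push_cast
    linear_combination this

theorem tele2 (M N : ℕ) :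
    2 * ∑ k ∈ Finset.range N, gC M (k + 1) * (((k : ℂ) + 1) * (har (k + 1) + har k)) =
    2 * M * ∑ k ∈ Finset.range N, gC M (k + 1) * ((k : ℂ) + 1)⁻¹
      - gC M N * (M - N) * (2 * har N) := by
  induction N with
  | zero => simp [gC, har]
  | succ N ih =>
    rw [Finset.sum_range_succ, mul_add, ih, Finset.sum_range_succ, har_succ]
    have := gC_step M N
    have h0 : ((N : ℂ) + 1) ≠ 0 := by exact_mod_cast Nat.succ_ne_zero N
    push_cast
    linear_combination (2 * har N) * this

theorem starS_one (w : ℕ → ℕ → ℂ) (h0 : ∀ m : ℕ, w 0 (m + 1) = ((m : ℂ) + 1)⁻¹) (M : ℕ) :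
    starS w 1 M = har M := by
  simp [starS, har, h0]

theorem gSum_one (M : ℕ) : gSum (fun k => (k : ℂ)⁻¹) M = har M := by
  induction M with
  | zero => simp [gSum, har]
  | succ M ih =>
    have h0 : ((M : ℂ) + 1) ≠ 0 := by exact_mod_cast Nat.succ_ne_zero M
    rw [gSum_diff (fun k => (k : ℂ)), ih, har_succ]
    · congr 1
      have := tele1 (M + 1) (M + 1)
      simp only [sub_self, mul_zero, sub_zero] at this
      rw [gSum]
      push_cast at this ⊢
      rw [this]; field_simp
    · intro k
      have h0 : ((k : ℂ) + 1) ≠ 0 := by exact_mod_cast Nat.succ_ne_zero k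
      push_cast; field_simp

theorem gSum_two (w : ℕ → ℕ → ℂ) (h0 : ∀ m : ℕ, w 0 (m + 1) = ((m : ℂ) + 1)⁻¹)
    (h1 : ∀ m : ℕ, w 1 (m + 1) = ((m : ℂ) + 1)⁻¹) (M : ℕ) :
    starS w 2 M = gSum (fun k => (k : ℂ)⁻¹ * (har k + har (k - 1))) M := by
  induction M with
  | zero => simp [gSum, starS]
  | succ M ih =>
    have h0' : ((M : ℂ) + 1) ≠ 0 := by exact_mod_cast Nat.succ_ne_zero M
    rw [gSum_diff (fun k => (k : ℂ) * (har k + har (k - 1))), ← ih, starS_succ, starS_one w h0, h1]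
    · congr 1
      have := tele2 (M + 1) (M + 1)
      simp only [sub_self, mul_zero, sub_zero, zero_mul] at this
      have h2 := gSum_one (M + 1)
      rw [gSum] at h2 ⊢
      simp only [Nat.add_sub_cancel]
      push_cast at this h2 ⊢
      rw [this, ← h2]; field_simp
    · intro k
      have h0 : ((k : ℂ) + 1) ≠ 0 := by exact_mod_cast Nat.succ_ne_zero k
      push_cast; field_simp

theorem star_one_two (w : ℕ → ℕ → ℂ) (h0 : ∀ m : ℕ, w 0 (m + 1) = ((m : ℂ) + 1)⁻¹)
    (hw : ∀ n m : ℕ, w (n + 1) (m + 1) = (((m : ℂ) + 1) ^ 2)⁻¹) (n : ℕ) : ∀ M,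
    starS w (n + 1) M = gSum (fun k => (k : ℂ)⁻¹ * ((k : ℂ) ^ (2 * n))⁻¹) M := by
  induction n with
  | zero => intro M; rw [starS_one w h0]; simpa using (gSum_one M).symm
  | succ n ih =>
    refine gSum_step w (n + 1) _ _ ?_ (hw n) (fun M => ih (M + 1))
    intro k
    have h0 : ((k : ℂ) + 1) ≠ 0 := by exact_mod_cast Nat.succ_ne_zero k
    push_cast
    rw [mul_add 2 n 1, pow_add]
    field_simp

theorem star_one_one_two (w : ℕ → ℕ → ℂ) (h0 : ∀ m : ℕ, w 0 (m + 1) = ((m : ℂ) + 1)⁻¹)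
    (h1 : ∀ m : ℕ, w 1 (m + 1) = ((m : ℂ) + 1)⁻¹)
    (hw : ∀ n m : ℕ, w (n + 2) (m + 1) = (((m : ℂ) + 1) ^ 2)⁻¹) (n : ℕ) : ∀ M,
    starS w (n + 2) M =
      gSum (fun k => (k : ℂ)⁻¹ * (har k + har (k - 1)) * ((k : ℂ) ^ (2 * n))⁻¹) M := by
  induction n with
  | zero => intro M; rw [gSum_two w h0 h1]; simp
  | succ n ih =>
    refine gSum_step w (n + 2) _ _ ?_ (hw n) (fun M => ih (M + 1))
    intro k
    have h0 : ((k : ℂ) + 1) ≠ 0 := by exact_mod_cast Nat.succ_ne_zero k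
    push_cast
    rw [mul_add 2 n 1, pow_add]
    field_simp
    ring

theorem gSum_tendsto (φ : ℕ → ℂ) (h : Summable fun k => φ (k + 1)) :
    Tendsto (gSum φ) atTop (nhds (2 * ∑' k, φ (k + 1))) := by
  have e : gSum φ = fun M => 2 * ∑' k, gC M (k + 1) * φ (k + 1) := by
    funext M
    rw [gSum, tsum_eq_sum (s := Finset.range M)]
    intro k hk
    rw [gC_zero_of_lt M (k + 1) (by simpa [Nat.lt_succ_iff] using hk), zero_mul]
  rw [e]
  refine Tendsto.const_mul _ ?_
  refine tendsto_tsum_of_dominated_convergence (bound := fun k => ‖φ (k + 1)‖) h.norm ?_ ?_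
  · intro k
    simpa using (gC_tendsto (k + 1)).mul_const (φ (k + 1))
  · refine Eventually.of_forall fun M k => ?_
    rw [norm_mul]
    exact mul_le_of_le_one_left (norm_nonneg _) (gC_norm_le _ _)

theorem har_norm_le (k : ℕ) : ‖har k‖ ≤ k := by
  refine (norm_sum_le _ _).trans ?_
  refine (Finset.sum_le_card_nsmul _ _ 1 ?_).trans (by simp)
  intro m _
  rw [norm_inv]
  apply inv_le_one_of_one_le₀
  have := Complex.norm_natCast (m + 1)
  push_cast at this
  rw [this]; simp

theorem summable_zeta (k : ℕ) (hk : 2 ≤ k) :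
    Summable fun n : ℕ => ((n + 1 : ℕ) : ℂ) ^ (-(k : ℤ)) := by
  have h := (summable_nat_add_iff 1).2 (Complex.summable_one_div_nat_cpow (p := (k : ℂ)) |>.2 (by simp; omega))
  refine h.congr fun n => ?_
  simp [_root_.zpow_neg]

theorem summable_zetaStar (k : ℕ) (hk : 3 ≤ k) :
    Summable fun n : ℕ => har (n + 1) * ((n + 1 : ℕ) : ℂ) ^ (-(k : ℤ)) := by
  have h := (summable_zeta (k - 1) (by omega)).norm
  refine Summable.of_norm_bounded h fun n => ?_
  rw [norm_mul]
  refine (mul_le_mul_of_nonneg_right (har_norm_le (n + 1)) (norm_nonneg _)).trans (le_of_eq ?_)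
  obtain ⟨k, rfl⟩ : ∃ j, k = j + 1 := ⟨k - 1, by omega⟩
  rw [Nat.add_sub_cancel, norm_zpow, norm_zpow, Complex.norm_natCast]
  have : ((n + 1 : ℕ) : ℝ) ≠ 0 := by positivity
  simp only [_root_.zpow_neg, zpow_natCast, pow_succ]
  field_simp

theorem zetaStarOne_eq (k : ℕ) :
    zetaStarOne k = ∑' n : ℕ, har (n + 1) * ((n + 1 : ℕ) : ℂ) ^ (-(k : ℤ)) := by
  rw [zetaStarOne]
  congr 1; funext n; congr 1
  have h := Finset.sum_Ico_add' (fun m : ℕ => ((m : ℂ))⁻¹) 0 (n + 1) 1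
  rw [har, Finset.range_eq_Ico]
  push_cast at h
  rw [h]
  rfl

theorem lim_one_two (w : ℕ → ℕ → ℂ) (h0 : ∀ m : ℕ, w 0 (m + 1) = ((m : ℂ) + 1)⁻¹)
    (hw : ∀ n m : ℕ, w (n + 1) (m + 1) = (((m : ℂ) + 1) ^ 2)⁻¹) (n : ℕ) :
    Tendsto (starS w (n + 2)) atTop (nhds (2 * zetaVal (2 * n + 3))) := by
  have e := funext (star_one_two w h0 hw (n + 1))
  rw [e]
  have e2 : ∀ k : ℕ, (((k + 1 : ℕ) : ℂ)⁻¹ * (((k + 1 : ℕ) : ℂ) ^ (2 * (n + 1)))⁻¹) =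
      ((k + 1 : ℕ) : ℂ) ^ (-((2 * n + 3 : ℕ) : ℤ)) := by
    intro k
    rw [_root_.zpow_neg, zpow_natCast, ← mul_inv]; ring_nf
  have h := gSum_tendsto (fun k => (k : ℂ)⁻¹ * ((k : ℂ) ^ (2 * (n + 1)))⁻¹)
    ((summable_zeta (2 * n + 3) (by omega)).congr fun k => (e2 k).symm)
  simpa only [e2, zetaVal] using h

theorem lim_one_one_two (w : ℕ → ℕ → ℂ) (h0 : ∀ m : ℕ, w 0 (m + 1) = ((m : ℂ) + 1)⁻¹)
    (h1 : ∀ m : ℕ, w 1 (m + 1) = ((m : ℂ) + 1)⁻¹)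
    (hw : ∀ n m : ℕ, w (n + 2) (m + 1) = (((m : ℂ) + 1) ^ 2)⁻¹) (n : ℕ) :
    Tendsto (starS w (n + 3)) atTop
      (nhds (2 * (2 * zetaStarOne (2 * n + 3) - zetaVal (2 * n + 4)))) := by
  have e := funext (star_one_one_two w h0 h1 hw (n + 1))
  rw [e]
  have e2 : ∀ k : ℕ, (((k + 1 : ℕ) : ℂ)⁻¹ * (har (k + 1) + har (k + 1 - 1)) *
        (((k + 1 : ℕ) : ℂ) ^ (2 * (n + 1)))⁻¹) =
      2 * (har (k + 1) * ((k + 1 : ℕ) : ℂ) ^ (-((2 * n + 3 : ℕ) : ℤ))) -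
        ((k + 1 : ℕ) : ℂ) ^ (-((2 * n + 4 : ℕ) : ℤ)) := by
    intro k
    have h0 : ((k : ℂ) + 1) ≠ 0 := by exact_mod_cast Nat.succ_ne_zero k
    rw [Nat.add_sub_cancel, har_succ]
    simp only [_root_.zpow_neg, zpow_natCast, mul_add, pow_add]
    push_cast
    field_simp
    ring
  have s1 := (summable_zetaStar (2 * n + 3) (by omega)).mul_left 2
  have s2 := summable_zeta (2 * n + 4) (by omega)
  have h := gSum_tendsto (fun k => (k : ℂ)⁻¹ * (har k + har (k - 1)) * ((k : ℂ) ^ (2 * (n + 1)))⁻¹)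
    ((s1.sub s2).congr fun k => (e2 k).symm)
  simp only [e2] at h
  rw [s1.tsum_sub s2, tsum_mul_left, ← zetaStarOne_eq] at h
  exact h
section JT
variable (u : ℕ → ℕ → ℂ)

/-- The two by two determinant. -/
noncomputable def dJT : ℕ → ℕ → ℕ → ℂ
  | 0, _, _ => 1
  | L + 1, p, q => starS (fun j => u (j + 1)) (L + 1) p * starS u (L + 1) q -
      starS u (L + 2) p * starS (fun j => u (j + 1)) L q

theorem dJT_zero (L q : ℕ) : dJT u (L + 1) 0 q = 0 := by
  simp [dJT, starS_zero_right]

theorem dJT_diff (L p q : ℕ) :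
    dJT u (L + 1) (p + 1) (q + 1) - dJT u (L + 1) p (q + 1) =
      dJT u (L + 1) (p + 1) q - dJT u (L + 1) p q
        + u (L + 1) (p + 1) * u L (q + 1) * dJT u L (p + 1) (q + 1) := by
  cases L with
  | zero =>
    simp only [dJT, starS_succ]
    simp only [starS]
    ring
  | succ L =>
    simp only [dJT, starS_succ]
    ring

theorem dJT_diag (L p : ℕ) : dJT u (L + 1) (p + 1) (p + 1) - dJT u (L + 1) p (p + 1) = 0 := by
  have h1 := starS_succ (fun j => u (j + 1)) L p
  have h2 := starS_succ u (L + 1) p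
  simp only [dJT]
  rw [h1, h2]; ring

theorem dJT_inner (L p q : ℕ) (h : p ≤ q) :
    ∑ j ∈ Finset.range (q + 1), (if p < j then
      u (L + 1) (p + 1) * u L (j + 1) * dJT u L (p + 1) (j + 1) else 0) =
    dJT u (L + 1) (p + 1) (q + 1) - dJT u (L + 1) p (q + 1) := by
  induction q, h using Nat.le_induction with
  | base =>
    rw [dJT_diag]
    refine Finset.sum_eq_zero fun j hj => if_neg ?_
    have := Finset.mem_range.1 hj; omega
  | succ q hq ih =>
    rw [Finset.sum_range_succ, ih, if_pos (by omega), dJT_diff u L p (q + 1)]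

theorem dJT_outer (L p q : ℕ) (h : p ≤ q + 1) :
    ∑ i ∈ Finset.range p, ∑ j ∈ Finset.range (q + 1), (if i < j then
      u (L + 1) (i + 1) * u L (j + 1) * dJT u L (i + 1) (j + 1) else 0) =
    dJT u (L + 1) p (q + 1) := by
  induction p with
  | zero => simp [dJT_zero]
  | succ p ih => rw [Finset.sum_range_succ, ih (by omega), dJT_inner u L p q (by omega)]; ring
end JT

section Mono
variable {α : Type*} [Fintype α] [PartialOrder α]

open Classical in
/-- Sums over bounded monotone sequences, recursively. -/
noncomputable def monoQ (w : ℕ → α → ℂ) : ℕ → α → ℂ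
  | 0, _ => 1
  | L + 1, t => ∑ a, if a ≤ t then w L a * monoQ w L a else 0

open Classical in
theorem monoQ_eq (w : ℕ → α → ℂ) (L : ℕ) (t : α) :
    (∑ g : Fin L → α, if Monotone g ∧ ∀ i, g i ≤ t then ∏ i : Fin L, w i (g i) else 0) = monoQ w L t := by
  induction L generalizing t with
  | zero =>
    simp [monoQ, Subsingleton.monotone]
  | succ L ih =>
    rw [monoQ, ← (Fin.snocEquiv (fun _ : Fin (L + 1) => α)).sum_comp, Fintype.sum_prod_type]
    refine Finset.sum_congr rfl fun a _ => ?_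
    rw [← ih, Finset.mul_sum]
    split_ifs with ha
    · refine Finset.sum_congr rfl fun g _ => ?_
      have key : (Monotone ((Fin.snocEquiv (fun _ : Fin (L + 1) => α)) (a, g)) ∧
          ∀ i, (Fin.snocEquiv (fun _ : Fin (L + 1) => α)) (a, g) i ≤ t) ↔
          (Monotone g ∧ ∀ i, g i ≤ a) := by
        simp only [Fin.snocEquiv_apply]
        constructor
        · rintro ⟨hm, -⟩
          constructor
          · intro i j hij
            simpa using hm (Fin.castSucc_le_castSucc_iff.2 hij)
          · intro i
            simpa using hm (Fin.le_last i.castSucc)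
        · rintro ⟨hm, hb⟩
          constructor
          · intro i j
            induction j using Fin.lastCases with
            | last =>
              induction i using Fin.lastCases with
              | last => simp
              | cast i => intro _; simpa using hb i
            | cast j =>
              induction i using Fin.lastCases with
              | last => intro h; exact absurd h (by simp [Fin.le_def])
              | cast i => intro h; simpa using hm (Fin.castSucc_le_castSucc_iff.1 h)
          · intro i
            induction i using Fin.lastCases with
            | last => simpa using ha
            | cast i => simpa using (hb i).trans ha
      by_cases hk : Monotone g ∧ ∀ i, g i ≤ a
      · rw [if_pos (key.2 hk), if_pos hk, Fin.prod_univ_castSucc]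
        simp [mul_comm]
      · rw [if_neg (fun h => hk (key.1 h)), if_neg hk, mul_zero]
    · refine Finset.sum_eq_zero fun g _ => if_neg ?_
      rintro ⟨-, h⟩
      exact ha (by simpa using h (Fin.last L))
end Mono

theorem monoQ_dJT (u : ℕ → ℕ → ℂ) (M L : ℕ) (p q : Fin M) (h : p ≤ q) :
    monoQ (fun j (a : Fin M × Fin M) => if a.1 < a.2 then
      u (j + 1) ((a.1 : ℕ) + 1) * u j ((a.2 : ℕ) + 1) else 0) L (p, q) =
      dJT u L ((p : ℕ) + 1) ((q : ℕ) + 1) := by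
  induction L generalizing p q with
  | zero => simp [monoQ, dJT]
  | succ L ih =>
    rw [monoQ, Fintype.sum_prod_type, ← dJT_outer u L (p + 1) q (by have := Fin.le_def.1 h; omega)]
    have e : ∀ (i j : Fin M), (if (i, j) ≤ (p, q) then
        (if (i, j).1 < (i, j).2 then u (L + 1) (((i, j).1 : ℕ) + 1) * u L (((i, j).2 : ℕ) + 1) else 0) *
        monoQ (fun j (a : Fin M × Fin M) => if a.1 < a.2 then
          u (j + 1) ((a.1 : ℕ) + 1) * u j ((a.2 : ℕ) + 1) else 0) L (i, j) else 0) =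
        (fun x y : ℕ => if x < p + 1 then (if y < q + 1 then (if x < y then
      u (L + 1) (x + 1) * u L (y + 1) * dJT u L (x + 1) (y + 1) else 0) else 0) else 0) i j := by
      intro i j
      by_cases hij : i < j
      · have := ih i j hij.le
        simp only [this, Prod.mk_le_mk, Nat.lt_succ_iff, Fin.le_def, Fin.lt_def]
        split_ifs <;> simp_all
      · have h2 : ¬ ((i : ℕ) < j) := hij
        simp [hij, h2]
    simp only [e]
    rw [Fin.sum_univ_eq_sum_range (fun x => ∑ j : Fin M, (fun x y : ℕ => if x < p + 1 then (if y < q + 1 then (if x < y then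
      u (L + 1) (x + 1) * u L (y + 1) * dJT u L (x + 1) (y + 1) else 0) else 0) else 0) x j) M]
    have hs : Finset.range (p + 1) ⊆ Finset.range M := Finset.range_mono (by omega)
    rw [← Finset.sum_subset hs]
    · refine Finset.sum_congr rfl fun x hx => ?_
      rw [Fin.sum_univ_eq_sum_range (fun y => (fun x y : ℕ => if x < p + 1 then (if y < q + 1 then (if x < y then
      u (L + 1) (x + 1) * u L (y + 1) * dJT u L (x + 1) (y + 1) else 0) else 0) else 0) x y) M]
      have hs2 : Finset.range (q + 1) ⊆ Finset.range M := Finset.range_mono (by omega)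
      rw [← Finset.sum_subset hs2]
      · refine Finset.sum_congr rfl fun y hy => ?_
        simp only [if_pos (Finset.mem_range.1 hx), if_pos (Finset.mem_range.1 hy)]
      · intro y _ hy
        rw [Finset.mem_range] at hy
        simp [hy]
    · intro x _ hx
      rw [Finset.mem_range] at hx
      simp [hx]

theorem mem_cells (L : ℕ) (p : ℕ × ℕ) :
    p ∈ cellsD 2 (fun i => if i < 2 then L else 0) (fun _ => 0) ↔ p.1 < 2 ∧ p.2 < L := by
  simp only [cellsD, Finset.mem_filter, Finset.mem_product, Finset.mem_range]
  constructor
  · rintro ⟨⟨h1, _⟩, _, h2⟩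
    rw [if_pos h1] at h2
    exact ⟨h1, h2⟩
  · rintro ⟨h1, h2⟩
    rw [if_pos h1]
    refine ⟨⟨h1, ?_⟩, Nat.zero_le _, h2⟩
    simp; omega

def cellEquiv (L : ℕ) : ↥(cellsD 2 (fun i => if i < 2 then L else 0) (fun _ => 0)) ≃ Fin 2 × Fin L where
  toFun c := (⟨c.1.1, ((mem_cells L c.1).1 c.2).1⟩, ⟨c.1.2, ((mem_cells L c.1).1 c.2).2⟩)
  invFun x := ⟨((x.1 : ℕ), (x.2 : ℕ)), (mem_cells L _).2 ⟨x.1.2, x.2.2⟩⟩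
  left_inv c := by simp
  right_inv x := by simp

def tabEquiv (L M : ℕ) : (↥(cellsD 2 (fun i => if i < 2 then L else 0) (fun _ => 0)) → Fin M) ≃
    (Fin L → Fin M × Fin M) where
  toFun T := fun j => (T ((cellEquiv L).symm (0, j)), T ((cellEquiv L).symm (1, j)))
  invFun g := fun c => if (cellEquiv L c).1 = 0 then (g (cellEquiv L c).2).1 else (g (cellEquiv L c).2).2
  left_inv T := by
    funext c
    obtain ⟨⟨a, b⟩, rfl⟩ := (cellEquiv L).symm.surjective c
    fin_cases a <;> simp
  right_inv g := by
    funext j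
    simp

theorem isSSYT_iff (L M : ℕ) (T : ↥(cellsD 2 (fun i => if i < 2 then L else 0) (fun _ => 0)) → Fin M) :
    IsSSYT T ↔ Monotone (tabEquiv L M T) ∧ ∀ j, (tabEquiv L M T j).1 < (tabEquiv L M T j).2 := by
  constructor
  · rintro ⟨h1, h2⟩
    refine ⟨fun i j hij => ⟨h1 _ _ rfl hij, h1 _ _ rfl hij⟩, fun j => h2 _ _ ?_ rfl⟩
    simp [cellEquiv]
  · rintro ⟨h1, h2⟩
    constructor
    · intro c c'
      obtain ⟨⟨a, b⟩, rfl⟩ := (cellEquiv L).symm.surjective c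
      obtain ⟨⟨a', b'⟩, rfl⟩ := (cellEquiv L).symm.surjective c'
      intro e1 e2
      have e1' : a = a' := Fin.ext e1
      subst e1'
      have := h1 (show b ≤ b' from e2)
      fin_cases a
      · exact this.1
      · exact this.2
    · intro c c'
      obtain ⟨⟨a, b⟩, rfl⟩ := (cellEquiv L).symm.surjective c
      obtain ⟨⟨a', b'⟩, rfl⟩ := (cellEquiv L).symm.surjective c'
      intro e1 e2
      have e2' : b = b' := Fin.ext e2
      subst e2'
      have e1' : a < a' := e1
      have := h2 b
      fin_cases a <;> fin_cases a' <;> first | exact this | (exact absurd e1' (by decide))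

theorem tabSum_two (L M : ℕ) (f : ℕ → ℕ × ℕ → ℂ) (u : ℕ → ℕ → ℂ)
    (h0 : ∀ k j, f (k + 1) (0, j) = u (j + 1) (k + 1)) (h1 : ∀ k j, f (k + 1) (1, j) = u j (k + 1)) :
    tabSum (M + 1) 2 (fun i => if i < 2 then L else 0) (fun _ => 0) f = dJT u L (M + 1) (M + 1) := by
  classical
  have hm := monoQ_dJT u (M + 1) L (Fin.last M) (Fin.last M) le_rfl
  rw [← monoQ_eq] at hm
  simp only [Fin.val_last] at hm
  rw [← hm, tabSum, Finset.sum_filter]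
  refine Fintype.sum_equiv (tabEquiv L (M + 1)) _ _ fun T => ?_
  have hle : ∀ i, tabEquiv L (M + 1) T i ≤ (Fin.last M, Fin.last M) := fun i =>
    ⟨Fin.le_last _, Fin.le_last _⟩
  have hp : ∏ c, f ((T c : ℕ) + 1) c.val = ∏ i : Fin L,
      (u (i + 1) (((tabEquiv L (M + 1) T i).1 : ℕ) + 1) * u i (((tabEquiv L (M + 1) T i).2 : ℕ) + 1)) := by
    rw [← (cellEquiv L).symm.prod_comp, Fintype.prod_prod_type, Fin.prod_univ_two,
      ← Finset.prod_mul_distrib]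
    refine Finset.prod_congr rfl fun i _ => ?_
    rw [← h0, ← h1]
    rfl
  rw [Finset.prod_ite_zero, hp]
  by_cases hT : IsSSYT T
  · have := (isSSYT_iff L (M + 1) T).1 hT
    rw [if_pos hT, if_pos ⟨this.1, hle⟩, if_pos (fun i _ => this.2 i)]
  · rw [if_neg hT]
    by_cases hM : Monotone (tabEquiv L (M + 1) T)
    · rw [if_pos ⟨hM, hle⟩, if_neg]
      intro h
      exact hT ((isSSYT_iff L (M + 1) T).2 ⟨hM, fun j => h j (Finset.mem_univ _)⟩)
    · rw [if_neg (fun h => hM h.1)]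

noncomputable def uW (j m : ℕ) : ℂ := if j < 2 then (m : ℂ)⁻¹ else ((m : ℂ) ^ 2)⁻¹

/-- Evaluation of a two-row Schur multiple zeta value (second formula of the
concluding Remark). -/
theorem two_row_schur_zeta_eval_two (c : ℕ) :
    Filter.Tendsto
        (fun M => zetaTF M 2 (fun i => if i < 2 then c + 3 else 0) (fun _ => 0)
          (fun cc =>
            if cc.1 = 0 then (if cc.2 = 0 then (1 : ℂ) else 2)
            else (if cc.2 < 2 then (1 : ℂ) else 2)))
        Filter.atTop
        (nhds
          (8 * (zetaStarOne (2 * c + 3) * zetaVal (2 * c + 5) -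
              zetaStarOne (2 * c + 5) * zetaVal (2 * c + 3)) -
            4 * (zetaVal (2 * c + 4) * zetaVal (2 * c + 5) -
              zetaVal (2 * c + 3) * zetaVal (2 * c + 6)))) := by
  have hX := lim_one_two (fun j => uW (j + 1)) (fun m => by simp [uW]) (fun n m => by simp [uW])
  have hY := lim_one_one_two uW (fun m => by simp [uW]) (fun m => by simp [uW]) (fun n m => by simp [uW])
  have hlim := ((hX (c + 1)).mul (hY c)).sub ((hY (c + 1)).mul (hX c))
  rw [← tendsto_add_atTop_iff_nat 1]
  have hlim' := (tendsto_add_atTop_iff_nat 1).2 hlim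
  convert hlim' using 2
  · rename_i M
    rw [zetaTF, tabSum_two (c + 3) M _ uW]
    · rfl
    · intro k j
      by_cases hj : j = 0
      · simp [uW, hj, Complex.cpow_neg_one]
      · have : ¬ (j + 1 < 2) := by omega
        simp [uW, hj, this, Complex.cpow_neg]
    · intro k j
      by_cases hj : j < 2
      · simp [uW, hj, Complex.cpow_neg_one]
      · simp [uW, hj, Complex.cpow_neg]
  · rw [show 2 * (c + 1) + 3 = 2 * c + 5 by ring, show 2 * (c + 1) + 4 = 2 * c + 6 by ring]
    ring
end
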